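/- arXiv:math/0409200 — 4 statements merged into one kernel-verified Lean document; each statement's English description precedes it below -/
import Mathlib

section
/- A norm on the plane is Radon (i.e., Birkhoff normality is symmetric) if and only if for all nonzero x, y: whenever x ⊣ λx + y and y ⊣ μy + x, one has λμ ≥ 0. -/
/-- Birkhoff normality: `x ⊣ y` iff `‖x‖ ≤ ‖x + t • y‖` for all `t`. -/
def BNormal {V : Type*} [NormedAddCommGroup V] [NormedSpace ℝ V] (x y : V) : Prop :=
  ∀ t : ℝ, ‖x‖ ≤ ‖x + t • y‖

/-- A norm on the plane is Radon (Birkhoff normality is symmetric) iff for all nonzero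
`x, y`: whenever `x ⊣ l • x + y` and `y ⊣ m • y + x`, one has `l * m ≥ 0`. -/
theorem stmt11 {V : Type*} [NormedAddCommGroup V] [NormedSpace ℝ V]
    (hdim : Module.finrank ℝ V = 2) :
    (∀ x y : V, x ≠ 0 → y ≠ 0 → BNormal x y → BNormal y x) ↔
    (∀ x y : V, x ≠ 0 → y ≠ 0 → ∀ l m : ℝ,
      BNormal x (l • x + y) → BNormal y (m • y + x) → 0 ≤ l * m) := by
  constructor
  · intro hR x y hx hy l m h1 h2
    by_contra hneg
    push Not at hneg
    have hy0 : 0 < ‖y‖ := norm_pos_iff.mpr hy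
    have hpos : 0 < 1 - l * m := by linarith
    have key : (1 - l * m) * ‖y‖ ≤ ‖l • x + y‖ := by
      have e : l • x + y = (1 - l * m) • (y + (l / (1 - l * m)) • (m • y + x)) := by
        rw [smul_add, smul_smul, mul_div_cancel₀ _ hpos.ne']
        module
      rw [e, norm_smul, Real.norm_of_nonneg hpos.le]
      exact mul_le_mul_of_nonneg_left (h2 _) hpos.le
    have hu : l • x + y ≠ 0 := by
      intro h
      rw [h, norm_zero] at key
      nlinarith
    have h3 := hR x _ hx hu h1 (-l)
    have e2 : l • x + y + (-l) • x = y := by module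
    rw [e2] at h3
    nlinarith
  · intro hC x y hx hy hxy
    by_contra hn
    unfold BNormal at hn
    push Not at hn
    obtain ⟨t, ht⟩ := hn
    have hx0 : 0 < ‖x‖ := norm_pos_iff.mpr hx
    have ht0 : t ≠ 0 := by
      rintro rfl
      simp at ht
    have htx : 0 < |t| * ‖x‖ := mul_pos (abs_pos.mpr ht0) hx0
    obtain ⟨e, he0, he1, he2⟩ : ∃ e : ℝ, 0 < e ∧ e < 1 ∧
        e * (|t| * ‖x‖) < ‖y‖ - ‖y + t • x‖ := by
      have hq : 0 < (‖y‖ - ‖y + t • x‖) / (|t| * ‖x‖) := div_pos (by linarith) htx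
      obtain ⟨e, h0, h1⟩ := exists_between (lt_min one_pos hq)
      exact ⟨e, h0, lt_of_lt_of_le h1 (min_le_left _ _),
        (lt_div_iff₀ htx).mp (lt_of_lt_of_le h1 (min_le_right _ _))⟩
    have hs0 : e * t ≠ 0 := mul_ne_zero he0.ne' ht0
    set z : V := y + (e * t) • x with hz
    have hzn : ‖y + t • x‖ < ‖z‖ := by
      have h1 : ‖y‖ ≤ ‖z‖ + e * (|t| * ‖x‖) := by
        have e1 : y = z - (e * t) • x := by rw [hz]; module
        calc ‖y‖ = ‖z - (e * t) • x‖ := by rw [← e1]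
          _ ≤ ‖z‖ + ‖(e * t) • x‖ := norm_sub_le _ _
          _ = _ := by
            rw [norm_smul, Real.norm_eq_abs, abs_mul, abs_of_pos he0]; ring
      linarith
    have hz0p : 0 < ‖z‖ := lt_of_le_of_lt (norm_nonneg _) hzn
    have hz0 : z ≠ 0 := norm_pos_iff.mp hz0p
    obtain ⟨g, hg1, hgz⟩ := exists_dual_vector ℝ z hz0p.ne'
    have hgz' : g z = ‖z‖ := by simpa using hgz
    have hgle : ∀ w, g w ≤ ‖w‖ := fun w => by
      have := g.le_opNorm w
      rw [hg1, one_mul] at this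
      exact (le_abs_self _).trans this
    have h1 : BNormal x ((-(e * t)) • x + z) := by
      have : (-(e * t)) • x + z = y := by rw [hz]; module
      rwa [this]
    have h2 : BNormal z ((-(g x / ‖z‖)) • z + x) := by
      intro r
      refine le_trans (le_of_eq ?_) (hgle _)
      simp only [map_add, map_smul, smul_eq_mul, hgz']
      field_simp
      ring
    have h3 := hC x z hx hz0 _ _ h1 h2
    have h4 : g (y + t • x) < g z := by
      rw [hgz']; exact lt_of_le_of_lt (hgle _) hzn
    simp only [hz, map_add, map_smul, smul_eq_mul] at h4
    have h5 : t * g x < 0 := by nlinarith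
    have h6 : (-(e * t)) * (-(g x / ‖z‖)) = e * (t * g x) / ‖z‖ := by ring
    rw [h6] at h3
    have h7 : e * (t * g x) / ‖z‖ < 0 := div_neg_of_neg_of_pos (mul_neg_of_pos_of_neg he0 h5) hz0p
    linarith
end

section
/- The area of a triangle a₁a₂a₃ in a Minkowski plane equals (1/2)·βᵢ·η_{a,i} for each i, where βᵢ is the length in the norm of the side opposite aᵢ and η_{a,i} is the distance in the antinorm from aᵢ to the line containing the opposite side. -/
/-- The antinorm associated with a norm and a symplectic form `ω`:
`anorm ω x = sup {ω x y : ‖y‖ = 1}`. -/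
noncomputable def anorm {V : Type*} [NormedAddCommGroup V] [NormedSpace ℝ V]
    (ω : V →ₗ[ℝ] V →ₗ[ℝ] ℝ) (x : V) : ℝ :=
  sSup {r : ℝ | ∃ y : V, ‖y‖ = 1 ∧ r = ω x y}

open MeasureTheory Pointwise

lemma aux_skew {V : Type*} [NormedAddCommGroup V] [NormedSpace ℝ V]
    (ω : V →ₗ[ℝ] V →ₗ[ℝ] ℝ) (halt : ∀ x : V, ω x x = 0) (x y : V) : ω x y = - ω y x := by
  have h := halt (x + y)
  simp [halt] at h
  linarith

lemma aux_hull {V : Type*} [NormedAddCommGroup V] [NormedSpace ℝ V] (a b c z : V) :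
    z ∈ convexHull ℝ {a, b, c} ↔
      ∃ s t : ℝ, 0 ≤ s ∧ 0 ≤ t ∧ s + t ≤ 1 ∧ z = a + s • (b - a) + t • (c - a) := by
  constructor
  · intro h
    rw [convexHull_insert (by simp), convexHull_pair] at h
    obtain ⟨a', ha', w, hw, hz⟩ := mem_convexJoin.1 h
    rw [Set.mem_singleton_iff] at ha'
    subst ha'
    obtain ⟨p, q, hp, hq, hpq, rfl⟩ := hw
    obtain ⟨u, v, hu, hv, huv, rfl⟩ := hz
    refine ⟨v * p, v * q, by positivity, by positivity, ?_, ?_⟩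
    · rw [← mul_add, hpq]; linarith
    · have h1 : u = 1 - v * p - v * q := by
        rw [sub_sub, ← mul_add, hpq]; linarith
      rw [h1]
      module
  · rintro ⟨s, t, hs, ht, hst, rfl⟩
    have h := (convex_convexHull ℝ ({a, b, c} : Set V)).sum_mem (t := Finset.univ)
      (w := ![1 - s - t, s, t]) (z := ![a, b, c])
      (by intro i _; fin_cases i <;> simp <;> linarith)
      (by simp [Fin.sum_univ_three]; ring)
      (by intro i _; apply subset_convexHull; fin_cases i <;> simp)
    simp only [Fin.sum_univ_three] at h
    convert h using 1
    simp
    module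

lemma aux_area {V : Type*} [NormedAddCommGroup V] [NormedSpace ℝ V]
    [MeasurableSpace V] [BorelSpace V] [FiniteDimensional ℝ V]
    (ω : V →ₗ[ℝ] V →ₗ[ℝ] ℝ)
    (halt : ∀ x : V, ω x x = 0)
    (μ : Measure V) [μ.IsAddHaarMeasure]
    (hμω : ∀ x y : V,
      μ (Set.image2 (fun s t : ℝ => s • x + t • y) (Set.Icc 0 1) (Set.Icc 0 1)) =
        ENNReal.ofReal |ω x y|)
    (a b c : V) :
    (μ (convexHull ℝ {a, b, c})).toReal = 1 / 2 * |ω (b - a) (c - a)| := by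
  set x := b - a with hx
  set y := c - a with hy
  set T := convexHull ℝ {a, b, c} with hT
  have hTm : ∀ z, z ∈ T ↔ ∃ s t : ℝ, 0 ≤ s ∧ 0 ≤ t ∧ s + t ≤ 1 ∧ z = a + s • x + t • y :=
    aux_hull a b c
  have hpar : ∀ d u v : V, μ ((fun z => -d + z) ⁻¹'
      (Set.image2 (fun s t : ℝ => s • u + t • v) (Set.Icc 0 1) (Set.Icc 0 1))) =
        ENNReal.ofReal |ω u v| := by
    intro d u v
    rw [measure_preimage_add, hμω]
  by_cases h0 : ω x y = 0
  · have : μ T = 0 := by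
      refine measure_mono_null ?_ ((hpar a x y).trans (by simp [h0]))
      intro z hz
      obtain ⟨s, t, hs, ht, hst, rfl⟩ := (hTm z).1 hz
      refine ⟨s, ⟨hs, by linarith⟩, t, ⟨ht, by linarith⟩, ?_⟩
      simp only
      module
    simp [this, h0]
  have hcomp : IsCompact T := (Set.toFinite {a, b, c}).isCompact_convexHull (𝕜 := ℝ)
  have hmeas : MeasurableSet T := hcomp.isClosed.measurableSet
  set T' := (fun z => (a + a + x + y) - z) ⁻¹' T with hT'
  have hmT' : μ T' = μ T :=
    (Measure.measurePreserving_sub_left μ (a + a + x + y)).measure_preimage hmeas.nullMeasurableSet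
  have hmeas' : MeasurableSet T' := (measurable_const.sub measurable_id) hmeas
  have hU : T ∪ T' = (fun z => -a + z) ⁻¹'
      (Set.image2 (fun s t : ℝ => s • x + t • y) (Set.Icc 0 1) (Set.Icc 0 1)) := by
    ext z
    constructor
    · rintro (hz | hz)
      · obtain ⟨s, t, hs, ht, hst, rfl⟩ := (hTm z).1 hz
        refine ⟨s, ⟨hs, by linarith⟩, t, ⟨ht, by linarith⟩, ?_⟩
        simp only
        module
      · obtain ⟨s, t, hs, ht, hst, h⟩ := (hTm _).1 hz
        beta_reduce at h
        refine ⟨1 - s, ⟨by linarith, by linarith⟩, 1 - t, ⟨by linarith, by linarith⟩, ?_⟩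
        have : z = (a + a + x + y) - (a + s • x + t • y) := by rw [← h]; abel
        simp only [this]
        module
    · rintro ⟨s, ⟨hs, hs1⟩, t, ⟨ht, ht1⟩, h⟩
      beta_reduce at h
      have hz : z = a + (s • x + t • y) := by rw [h]; abel
      rcases le_total (s + t) 1 with h1 | h1
      · left
        exact (hTm z).2 ⟨s, t, hs, ht, h1, by rw [hz]; abel⟩
      · right
        refine (hTm _).2 ⟨1 - s, 1 - t, by linarith, by linarith, by linarith, ?_⟩
        simp only [hz]
        module
  have hI : μ (T ∩ T') = 0 := by
    refine measure_mono_null ?_ ((hpar (a + x) (y - x) 0).trans (by simp))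
    rintro z ⟨hz, hz'⟩
    obtain ⟨s, t, hs, ht, hst, h⟩ := (hTm z).1 hz
    obtain ⟨s', t', hs', ht', hst', h'⟩ := (hTm _).1 hz'
    beta_reduce at h'
    have e : x + y = (s + s') • x + (t + t') • y := by
      have e1 : x + y = (a + a + x + y - z) + z - a - a := by abel
      rw [e1, h', h]
      module
    have e1 := congrArg (fun u => ω u y) e
    have e2 := congrArg (fun u => ω x u) e
    simp [halt] at e1 e2
    have k1 : s + s' = 1 := by
      apply mul_right_cancel₀ h0
      linarith
    have k2 : t + t' = 1 := by
      apply mul_right_cancel₀ h0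
      linarith
    have k3 : s = 1 - t := by linarith
    refine ⟨t, ⟨ht, by linarith⟩, 0, by simp, ?_⟩
    simp only [h, k3]
    module
  have key := measure_union_add_inter (μ := μ) T hmeas'
  rw [hI, hU, hpar, hmT', add_zero] at key
  have k := congrArg ENNReal.toReal key
  rw [ENNReal.toReal_add hcomp.measure_ne_top hcomp.measure_ne_top,
    ENNReal.toReal_ofReal (abs_nonneg _)] at k
  linarith

lemma aux_bdd {V : Type*} [NormedAddCommGroup V] [NormedSpace ℝ V] [FiniteDimensional ℝ V]
    (ω : V →ₗ[ℝ] V →ₗ[ℝ] ℝ) (x : V) : BddAbove {r : ℝ | ∃ y : V, ‖y‖ = 1 ∧ r = ω x y} := by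
  refine ⟨‖LinearMap.toContinuousLinearMap (ω x)‖, ?_⟩
  rintro r ⟨y, hy, rfl⟩
  have := (LinearMap.toContinuousLinearMap (ω x)).le_opNorm y
  rw [hy, mul_one] at this
  exact (le_abs_self _).trans this

lemma aux_dist {V : Type*} [NormedAddCommGroup V] [NormedSpace ℝ V]
    (hdim : Module.finrank ℝ V = 2) [FiniteDimensional ℝ V]
    (ω : V →ₗ[ℝ] V →ₗ[ℝ] ℝ)
    (halt : ∀ x : V, ω x x = 0)
    (hnd : ∀ a : V, (∀ y : V, ω a y = 0) → a = 0) (w v : V) (hv : v ≠ 0) :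
    ‖v‖ * sInf {d : ℝ | ∃ t : ℝ, d = anorm ω (w - t • v)} = |ω w v| := by
  have hn : 0 < ‖v‖ := norm_pos_iff.2 hv
  have hlow : ∀ t : ℝ, |ω w v| / ‖v‖ ≤ anorm ω (w - t • v) := by
    intro t
    have h1 : ‖(‖v‖⁻¹ • v)‖ = 1 := by
      rw [norm_smul, norm_inv, norm_norm, inv_mul_cancel₀ hn.ne']
    rcases abs_cases (ω w v) with ⟨h, _⟩ | ⟨h, _⟩
    · refine le_csSup (aux_bdd ω _) ⟨‖v‖⁻¹ • v, h1, ?_⟩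
      rw [h]
      simp [halt]
      ring
    · refine le_csSup (aux_bdd ω _) ⟨-(‖v‖⁻¹ • v), by rw [norm_neg, h1], ?_⟩
      rw [h]
      simp [halt]
      ring
  have hatt : ∃ t : ℝ, anorm ω (w - t • v) ≤ |ω w v| / ‖v‖ := by
    obtain ⟨g, hg, hgv⟩ := exists_dual_vector ℝ v hn.ne'
    have hinj : Function.Injective ω := by
      rw [injective_iff_map_eq_zero]
      intro a ha
      exact hnd a (by simp [ha])
    have hsurj : Function.Surjective ω :=
      (LinearMap.injective_iff_surjective_of_finrank_eq_finrank
        (by exact (Subspace.dual_finrank_eq).symm)).1 hinj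
    obtain ⟨u, hu⟩ := hsurj (g : V →ₗ[ℝ] ℝ)
    have hu' : ∀ z, ω u z = g z := fun z => by rw [hu]; rfl
    have hker : ω (w - (ω w v / ‖v‖) • u) v = 0 := by
      have : ω u v = ‖v‖ := by rw [hu', hgv]; simp
      simp [this]
      field_simp
      ring
    have hspan : ∃ t : ℝ, t • v = w - (ω w v / ‖v‖) • u := by
      set p := w - (ω w v / ‖v‖) • u
      by_contra hc
      push Not at hc
      have hli : LinearIndependent ℝ ![v, p] := (LinearIndependent.pair_iff' hv).2 hc
      have hsp := hli.span_eq_top_of_card_eq_finrank' (by simp [hdim])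
      apply hv
      apply hnd
      intro y
      have hy : y ∈ Submodule.span ℝ (Set.range ![v, p]) := by rw [hsp]; trivial
      have hle : Submodule.span ℝ (Set.range ![v, p]) ≤ LinearMap.ker (ω v) := by
        rw [Submodule.span_le]
        rintro _ ⟨i, rfl⟩
        fin_cases i
        · simp [halt]
        · simp [aux_skew ω halt v p, hker]
      exact hle hy
    obtain ⟨t, ht⟩ := hspan
    refine ⟨t, ?_⟩
    have : w - t • v = (ω w v / ‖v‖) • u := by rw [ht]; abel
    rw [this]
    have hb : ∀ y : V, ‖y‖ = 1 → ω ((ω w v / ‖v‖) • u) y ≤ |ω w v| / ‖v‖ := by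
      intro y hy
      have h2 : |g y| ≤ 1 := by
        have := g.le_opNorm y
        rwa [hg, hy, mul_one] at this
      rw [map_smul, LinearMap.smul_apply, hu', smul_eq_mul]
      refine (le_abs_self _).trans ?_
      rw [abs_mul, abs_div, abs_norm]
      exact mul_le_of_le_one_right (by positivity) h2
    apply Real.sSup_le
    · rintro r ⟨y, hy, rfl⟩
      exact hb y hy
    · positivity
  have hinf : sInf {d : ℝ | ∃ t : ℝ, d = anorm ω (w - t • v)} = |ω w v| / ‖v‖ := by
    obtain ⟨t, ht⟩ := hatt
    apply le_antisymm
    · refine le_trans (csInf_le ⟨|ω w v| / ‖v‖, ?_⟩ ⟨t, rfl⟩) ht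
      rintro _ ⟨t, rfl⟩
      exact hlow t
    · refine le_csInf ⟨_, 0, rfl⟩ ?_
      rintro _ ⟨t, rfl⟩
      exact hlow t
  rw [hinf]
  field_simp

/-- The area of a triangle `a₁ a₂ a₃` equals `(1/2)·β·ηₐ`, where `β` is the norm-length of
the side opposite `a₁` and `ηₐ` is the antinorm-distance from `a₁` to the line through the
opposite side. (By universality in `a₁ a₂ a₃`, this holds for each of the three sides.) -/
theorem stmt12 {V : Type*} [NormedAddCommGroup V] [NormedSpace ℝ V]
    [MeasurableSpace V] [BorelSpace V]
    (hdim : Module.finrank ℝ V = 2)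
    (ω : V →ₗ[ℝ] V →ₗ[ℝ] ℝ)
    (halt : ∀ x : V, ω x x = 0)
    (hnd : ∀ a : V, (∀ y : V, ω a y = 0) → a = 0)
    (μ : Measure V) [μ.IsAddHaarMeasure]
    (hμω : ∀ x y : V,
      μ (Set.image2 (fun s t : ℝ => s • x + t • y) (Set.Icc 0 1) (Set.Icc 0 1)) =
        ENNReal.ofReal |ω x y|)
    (a₁ a₂ a₃ : V) :
    (μ (convexHull ℝ {a₁, a₂, a₃})).toReal =
      (1 / 2) * ‖a₂ - a₃‖ *
        sInf {d : ℝ | ∃ t : ℝ, d = anorm ω (a₁ - (a₂ + t • (a₃ - a₂)))} := by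
  have : FiniteDimensional ℝ V := Module.finite_of_finrank_eq_succ hdim
  rw [aux_area ω halt μ hμω a₁ a₂ a₃]
  by_cases hv : a₃ - a₂ = 0
  · have : a₃ = a₂ := sub_eq_zero.1 hv
    rw [this]
    simp only [halt, sub_self, norm_zero, abs_zero, mul_zero, zero_mul]
  have h := aux_dist hdim ω halt hnd (a₁ - a₂) (a₃ - a₂) hv
  simp only [sub_sub] at h
  rw [norm_sub_rev a₂ a₃, mul_assoc, h]
  congr 1
  rw [← abs_neg]
  congr 1
  have e1 := aux_skew ω halt a₁ a₂
  have e2 := aux_skew ω halt a₁ a₃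
  have e3 := aux_skew ω halt a₂ a₃
  simp [halt]
  linarith
end

section
/- For any convex polygon P containing an anticircle of radius ρ (a translate of ρI, where I is the unit ball of the antinorm), ρ·L(∂P) ≤ 2·area(P), where L(∂P) is the perimeter of P measured in the norm; equality holds if and only if P is circumscribed about the anticircle. -/
open MeasureTheory Pointwise

section helpers
variable {V : Type*} [NormedAddCommGroup V] [NormedSpace ℝ V]

lemma h_anti (ω : V →ₗ[ℝ] V →ₗ[ℝ] ℝ) (halt : ∀ x : V, ω x x = 0) (x y : V) :
    ω y x = - ω x y := by
  have h := halt (x + y)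
  simp only [map_add, LinearMap.add_apply, halt] at h
  linarith

lemma h_decomp (hdim : Module.finrank ℝ V = 2) (ω : V →ₗ[ℝ] V →ₗ[ℝ] ℝ)
    (halt : ∀ x : V, ω x x = 0) (u w y : V) (h : ω u w ≠ 0) :
    ω u w • y = ω y w • u + ω u y • w := by
  have : FiniteDimensional ℝ V := Module.finite_of_finrank_pos (by omega)
  have li : LinearIndependent ℝ ![u, w] := by
    rw [LinearIndependent.pair_iff]
    intro s t hst
    have h1 := congrArg (fun v => ω u v) hst
    have h2 := congrArg (fun v => ω v w) hst
    simp [halt] at h1 h2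
    exact ⟨by tauto, by tauto⟩
  have hs := li.span_eq_top_of_card_eq_finrank' (by simp [hdim])
  have hy : y ∈ Submodule.span ℝ (Set.range ![u, w]) := by rw [hs]; trivial
  simp only [Matrix.range_cons, Matrix.range_empty, Set.union_empty, Set.singleton_union] at hy
  rw [Submodule.mem_span_pair] at hy
  obtain ⟨s, t, rfl⟩ := hy
  simp [halt, smul_smul]
  rw [mul_comm s, mul_comm t]

lemma h_par (hdim : Module.finrank ℝ V = 2) (ω : V →ₗ[ℝ] V →ₗ[ℝ] ℝ)
    (halt : ∀ x : V, ω x x = 0) (hnd : ∀ a : V, (∀ y : V, ω a y = 0) → a = 0)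
    (u y : V) (hu : u ≠ 0) (h : ω u y = 0) : ∃ k : ℝ, y = k • u := by
  have : ∃ w, ω u w ≠ 0 := by
    by_contra! hc
    exact hu (hnd u hc)
  obtain ⟨w, hw⟩ := this
  have := h_decomp hdim ω halt u w y hw
  rw [h, zero_smul, add_zero] at this
  refine ⟨(ω u w)⁻¹ * ω y w, ?_⟩
  rw [mul_smul, ← this, smul_smul, inv_mul_cancel₀ hw, one_smul]

lemma h_repr (hdim : Module.finrank ℝ V = 2) (ω : V →ₗ[ℝ] V →ₗ[ℝ] ℝ)
    (hnd : ∀ a : V, (∀ y : V, ω a y = 0) → a = 0)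
    (φ : V →L[ℝ] ℝ) : ∃ u : V, ∀ y, φ y = ω u y := by
  have : FiniteDimensional ℝ V := Module.finite_of_finrank_pos (by omega)
  have hinj : Function.Injective ω := by
    rw [injective_iff_map_eq_zero]
    intro a ha
    exact hnd a (fun y => by rw [ha]; rfl)
  have hfr : Module.finrank ℝ V = Module.finrank ℝ (V →ₗ[ℝ] ℝ) :=
    (Subspace.dual_finrank_eq (K := ℝ) (V := V)).symm
  have hs := (LinearMap.injective_iff_surjective_of_finrank_eq_finrank hfr).1 hinj
  obtain ⟨u, hu⟩ := hs (φ : V →ₗ[ℝ] ℝ)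
  exact ⟨u, fun y => by rw [hu]; rfl⟩

lemma h_bound (hdim : Module.finrank ℝ V = 2) (ω : V →ₗ[ℝ] V →ₗ[ℝ] ℝ) :
    ∃ K : ℝ, 0 < K ∧ ∀ x y, |ω x y| ≤ K * ‖x‖ * ‖y‖ := by
  have : FiniteDimensional ℝ V := Module.finite_of_finrank_pos (by omega)
  let A : V →ₗ[ℝ] (V →L[ℝ] ℝ) := (LinearMap.toContinuousLinearMap (𝕜 := ℝ) (E := V) (F' := ℝ)).toLinearMap ∘ₗ ω
  let B : V →L[ℝ] (V →L[ℝ] ℝ) := LinearMap.toContinuousLinearMap A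
  refine ⟨‖B‖ + 1, by positivity, fun x y => ?_⟩
  have h := B.le_opNorm₂ x y
  have h2 : B x y = ω x y := rfl
  rw [h2, Real.norm_eq_abs] at h
  refine h.trans ?_
  gcongr
  linarith

lemma h_cont (hdim : Module.finrank ℝ V = 2) (ω : V →ₗ[ℝ] V →ₗ[ℝ] ℝ) (u : V) :
    Continuous (fun y => ω u y) := by
  have : FiniteDimensional ℝ V := Module.finite_of_finrank_pos (by omega)
  exact LinearMap.continuous_of_finiteDimensional (ω u)

lemma h_anorm_le (hdim : Module.finrank ℝ V = 2) (ω : V →ₗ[ℝ] V →ₗ[ℝ] ℝ) :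
    ∃ K : ℝ, 0 < K ∧ ∀ x, anorm ω x ≤ K * ‖x‖ := by
  obtain ⟨K, hK, h⟩ := h_bound hdim ω
  refine ⟨K, hK, fun x => ?_⟩
  apply Real.sSup_le _ (by positivity)
  rintro r ⟨y, hy, rfl⟩
  have := h x y
  rw [hy, mul_one] at this
  exact (le_abs_self _).trans this

lemma h_ge (hdim : Module.finrank ℝ V = 2) (ω : V →ₗ[ℝ] V →ₗ[ℝ] ℝ)
    (z w : V) : ω z w ≤ anorm ω z * ‖w‖ := by
  obtain ⟨K, hK, h⟩ := h_bound hdim ω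
  by_cases hw : w = 0
  · simp [hw]
  have hw' : 0 < ‖w‖ := norm_pos_iff.2 hw
  have : ω z (‖w‖⁻¹ • w) ≤ anorm ω z := by
    apply le_csSup
    · refine ⟨K * ‖z‖, ?_⟩
      rintro r ⟨y, hy, rfl⟩
      have := h z y
      rw [hy, mul_one] at this
      exact (le_abs_self _).trans this
    · exact ⟨_, by rw [norm_smul, norm_inv, norm_norm, inv_mul_cancel₀ hw'.ne'], rfl⟩
  rw [map_smul, smul_eq_mul, inv_mul_le_iff₀ hw'] at this
  linarith

lemma h_att (hdim : Module.finrank ℝ V = 2) (ω : V →ₗ[ℝ] V →ₗ[ℝ] ℝ)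
    (hnd : ∀ a : V, (∀ y : V, ω a y = 0) → a = 0) (ρ : ℝ) (hρ : 0 < ρ)
    (w : V) : ∃ z, anorm ω z ≤ ρ ∧ ω z w = ρ * ‖w‖ := by
  obtain ⟨g, hg, hgw⟩ := exists_dual_vector'' ℝ w
  obtain ⟨z, hz⟩ := h_repr hdim ω hnd (ρ • g)
  refine ⟨z, ?_, by rw [← hz]; simp [hgw]⟩
  apply Real.sSup_le _ hρ.le
  rintro r ⟨y, hy, rfl⟩
  rw [← hz]
  have h1 : g y ≤ 1 := by
    have := g.le_opNorm y
    rw [hy, mul_one] at this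
    exact (le_abs_self _).trans (this.trans hg)
  simp
  nlinarith

lemma h_int (hdim : Module.finrank ℝ V = 2) (ω : V →ₗ[ℝ] V →ₗ[ℝ] ℝ) (P : Set V)
    (ρ : ℝ) (hρ : 0 < ρ) (c : V)
    (hD : {x : V | anorm ω (x - c) ≤ ρ} ⊆ P) : c ∈ interior P := by
  obtain ⟨K, hK, h⟩ := h_anorm_le hdim ω
  rw [mem_interior_iff_mem_nhds]
  refine Filter.mem_of_superset (Metric.closedBall_mem_nhds c (div_pos hρ hK)) ?_
  intro x hx
  apply hD
  rw [Metric.mem_closedBall, dist_eq_norm, le_div_iff₀ hK] at hx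
  refine (h _).trans ?_
  linarith

lemma h_pos (hdim : Module.finrank ℝ V = 2) (ω : V →ₗ[ℝ] V →ₗ[ℝ] ℝ)
    (hnd : ∀ a : V, (∀ y : V, ω a y = 0) → a = 0) (P : Set V) (u a y : V) (hu : u ≠ 0)
    (h : ∀ p ∈ P, 0 ≤ ω u (p - a)) (hy : y ∈ interior P) : 0 < ω u (y - a) := by
  have : ∃ w, ω u w ≠ 0 := by
    by_contra! hc
    exact hu (hnd u hc)
  obtain ⟨w, hw⟩ := this
  have hc : Continuous (fun t : ℝ => y - (t * ω u w) • w) := by fun_prop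
  have h0 : ∀ᶠ t in nhds (0 : ℝ), y - (t * ω u w) • w ∈ P := by
    apply hc.continuousAt
    simpa using mem_interior_iff_mem_nhds.1 hy
  obtain ⟨ε, hε, hb⟩ := Metric.eventually_nhds_iff.1 h0
  have h1 := h _ (hb (y := ε / 2) (by rw [Real.dist_eq, sub_zero, abs_of_pos (by positivity)]; linarith))
  rw [sub_right_comm, map_sub, map_smul, smul_eq_mul] at h1
  have : 0 < ω u w * ω u w := mul_self_pos.2 hw
  nlinarith

lemma h_support (hdim : Module.finrank ℝ V = 2) (ω : V →ₗ[ℝ] V →ₗ[ℝ] ℝ)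
    (hnd : ∀ a : V, (∀ y : V, ω a y = 0) → a = 0)
    (P : Set V) (hPc : IsCompact P) (hPv : Convex ℝ P) (hPi : (interior P).Nonempty)
    (x : V) (hx : x ∈ frontier P) : ∃ u : V, u ≠ 0 ∧ ∀ y ∈ P, 0 ≤ ω u (y - x) := by
  obtain ⟨f, hf⟩ := geometric_hahn_banach_open_point hPv.interior isOpen_interior hx.2
  obtain ⟨u, hu⟩ := h_repr hdim ω hnd (-f)
  refine ⟨u, ?_, ?_⟩
  · rintro rfl
    obtain ⟨q, hq⟩ := hPi
    have h1 := hf q hq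
    have h2 := hu q
    have h3 := hu x
    simp at h2 h3
    linarith
  · intro y hy
    have h1 : y ∈ closure (interior P) := by
      rw [hPv.closure_interior_eq_closure_of_nonempty_interior hPi]
      exact subset_closure hy
    have h2 : f y ≤ f x := by
      have : closure (interior P) ⊆ {y | f y ≤ f x} :=
        closure_minimal (fun q hq => (hf q hq).le) (isClosed_le f.continuous continuous_const)
      exact this h1
    rw [← hu]; simp; linarith

end helpers

section edges
variable {V : Type*} [NormedAddCommGroup V] [NormedSpace ℝ V]

/-- Oriented edges of the polygon `P`. -/
def IsPEdge (ω : V →ₗ[ℝ] V →ₗ[ℝ] ℝ) (P : Set V) (e : V × V) : Prop :=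
  e.1 ∈ Set.extremePoints ℝ P ∧ e.2 ∈ Set.extremePoints ℝ P ∧ e.1 ≠ e.2 ∧
    ∀ y ∈ P, 0 ≤ ω (e.2 - e.1) (y - e.1)

lemma e_front (hdim : Module.finrank ℝ V = 2) (ω : V →ₗ[ℝ] V →ₗ[ℝ] ℝ)
    (halt : ∀ x : V, ω x x = 0)
    (hnd : ∀ a : V, (∀ y : V, ω a y = 0) → a = 0)
    (P : Set V) (hPv : Convex ℝ P) (a b : V) (h : IsPEdge ω P (a, b)) :
    segment ℝ a b ⊆ frontier P := by
  obtain ⟨ha, hb, hab, hy⟩ := h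
  simp only at ha hb hab hy
  intro x hx
  refine ⟨subset_closure (hPv.segment_subset ha.1 hb.1 hx), fun hxi => ?_⟩
  have h1 := h_pos hdim ω hnd P (b - a) a x (sub_ne_zero.2 hab.symm) hy hxi
  rw [segment_eq_image'] at hx
  obtain ⟨t, ht, rfl⟩ := hx
  rw [add_sub_cancel_left, map_smul, halt] at h1
  simp at h1

/-- collinear extreme points -/
lemma ext_col (P : Set V) (a b d : V) (ha : a ∈ Set.extremePoints ℝ P)
    (hb : b ∈ Set.extremePoints ℝ P) (hd : d ∈ Set.extremePoints ℝ P) (hab : a ≠ b) (s : ℝ)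
    (hs : d - a = s • (b - a)) : d = a ∨ d = b := by
  have hd' : d = a + s • (b - a) := by rw [← hs]; abel
  by_contra! hc
  have hs0 : s ≠ 0 := by rintro rfl; apply hc.1; simpa using hd'
  have hs1 : s ≠ 1 := by rintro rfl; apply hc.2; simpa using hd'
  rcases lt_or_gt_of_ne hs0 with h0 | h0
  · have : a ∈ openSegment ℝ d b := by
      rw [openSegment_eq_image']
      refine ⟨-s / (1 - s), ⟨by apply div_pos <;> linarith, by rw [div_lt_one] <;> linarith⟩, ?_⟩
      have : 1 - s ≠ 0 := by linarith
      simp only [hd']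
      match_scalars <;> field_simp <;> ring
    have := (mem_extremePoints.1 ha).2 d hd.1 b hb.1 this
    exact hab this.2.symm
  · rcases lt_or_gt_of_ne hs1 with h1 | h1
    · have : d ∈ openSegment ℝ a b := by
        rw [openSegment_eq_image']
        exact ⟨s, ⟨h0, h1⟩, hd'.symm⟩
      have := (mem_extremePoints.1 hd).2 a ha.1 b hb.1 this
      exact hc.1 this.1.symm
    · have : b ∈ openSegment ℝ a d := by
        rw [openSegment_eq_image']
        refine ⟨1 / s, ⟨by positivity, by rw [div_lt_one] <;> linarith⟩, ?_⟩
        simp only [hd']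
        match_scalars <;> field_simp <;> ring
      have := (mem_extremePoints.1 hb).2 a ha.1 d hd.1 this
      exact hab this.1

lemma e_disj (hdim : Module.finrank ℝ V = 2) (ω : V →ₗ[ℝ] V →ₗ[ℝ] ℝ)
    (halt : ∀ x : V, ω x x = 0)
    (hnd : ∀ a : V, (∀ y : V, ω a y = 0) → a = 0)
    (P : Set V) (hPi : (interior P).Nonempty)
    (e e' : V × V) (h : IsPEdge ω P e) (h' : IsPEdge ω P e') (hne : e ≠ e') :
    segment ℝ e.1 e.2 ∩ segment ℝ e'.1 e'.2 ⊆ Set.extremePoints ℝ P := by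
  obtain ⟨a, b⟩ := e
  obtain ⟨a', b'⟩ := e'
  obtain ⟨ha, hb, hab, hy⟩ := h
  obtain ⟨ha', hb', hab', hy'⟩ := h'
  simp only at ha hb hab hy ha' hb' hab' hy' ⊢
  rintro x ⟨hx, hx'⟩
  by_contra hxE
  have hba : b - a ≠ 0 := sub_ne_zero.2 hab.symm
  rw [segment_eq_image'] at hx
  obtain ⟨t, ht, rfl⟩ := hx
  have h0 : ω (b - a) (a + t • (b - a) - a) = 0 := by
    rw [add_sub_cancel_left, map_smul, halt, smul_zero]
  set x := a + t • (b - a)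
  have hxo : x ∈ openSegment ℝ a' b' := by
    rw [← insert_endpoints_openSegment] at hx'
    rcases hx' with h | h | h
    · exact absurd (h ▸ ha') hxE
    · exact absurd (h ▸ hb') hxE
    · exact h
  obtain ⟨p, q, hp, hq, hpq, hx⟩ := hxo
  have e1 : x - a = p • (a' - a) + q • (b' - a) := by
    rw [← hx, show q = 1 - p by linarith]; module
  rw [e1, map_add, map_smul, map_smul, smul_eq_mul, smul_eq_mul] at h0
  have i1 := hy a' ha'.1
  have i2 := hy b' hb'.1
  have z1 : ω (b - a) (a' - a) = 0 := by
    have := mul_nonneg hp.le i1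
    have := mul_nonneg hq.le i2
    have : p * ω (b - a) (a' - a) = 0 := by linarith
    exact (mul_eq_zero.1 this).resolve_left hp.ne'
  have z2 : ω (b - a) (b' - a) = 0 := by
    have := mul_nonneg hp.le i1
    have := mul_nonneg hq.le i2
    have : q * ω (b - a) (b' - a) = 0 := by linarith
    exact (mul_eq_zero.1 this).resolve_left hq.ne'
  obtain ⟨k, hk⟩ := h_par hdim ω halt hnd _ _ hba z1
  obtain ⟨l, hl⟩ := h_par hdim ω halt hnd _ _ hba z2
  rcases ext_col P a b a' ha hb ha' hab k hk with r | r <;>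
  rcases ext_col P a b b' ha hb hb' hab l hl with r' | r'
  · exact hab' (r.trans r'.symm)
  · exact hne (by rw [r, r'])
  · obtain ⟨y, hyi⟩ := hPi
    have j1 := h_pos hdim ω hnd P _ a y hba hy hyi
    have j2 := hy' y (interior_subset hyi)
    rw [r, r'] at j2
    have : ω (a - b) (y - b) = - ω (b - a) (y - a) := by
      have : y - b = (y - a) - (b - a) := by abel
      rw [this, map_sub, ← neg_sub b a, map_neg, LinearMap.neg_apply, LinearMap.neg_apply, halt]
      ring
    linarith
  · exact hab' (r.trans r'.symm)

/-- A nontrivial supporting line containing two extreme points gives an edge. -/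
lemma e_mk (hdim : Module.finrank ℝ V = 2) (ω : V →ₗ[ℝ] V →ₗ[ℝ] ℝ)
    (halt : ∀ x : V, ω x x = 0)
    (hnd : ∀ a : V, (∀ y : V, ω a y = 0) → a = 0)
    (P : Set V) (u a b : V) (hu : u ≠ 0) (ha : a ∈ Set.extremePoints ℝ P)
    (hb : b ∈ Set.extremePoints ℝ P) (hab : a ≠ b)
    (hy : ∀ y ∈ P, 0 ≤ ω u (y - a)) (h0 : ω u (b - a) = 0) :
    IsPEdge ω P (a, b) ∨ IsPEdge ω P (b, a) := by
  obtain ⟨k, hk⟩ := h_par hdim ω halt hnd _ _ hu h0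
  have hk0 : k ≠ 0 := by
    rintro rfl
    rw [zero_smul] at hk
    exact hab (sub_eq_zero.1 hk).symm
  rcases lt_or_gt_of_ne hk0 with h | h
  · right
    refine ⟨hb, ha, hab.symm, fun y hyP => ?_⟩
    have e1 : a - b = (-k) • u := by rw [neg_smul, ← hk]; abel
    have e2 : y - b = (y - a) - (b - a) := by abel
    simp only
    rw [e1, e2, map_smul, LinearMap.smul_apply, map_sub, h0, sub_zero, smul_eq_mul]
    exact mul_nonneg (by linarith) (hy y hyP)
  · left
    refine ⟨ha, hb, hab, fun y hyP => ?_⟩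
    simp only
    rw [hk, map_smul, LinearMap.smul_apply, smul_eq_mul]
    exact mul_nonneg h.le (hy y hyP)

lemma e_hull (P : Set V) (hPc : IsCompact P) (hPv : Convex ℝ P) 
    (hPpoly : (Set.extremePoints ℝ P).Finite) : convexHull ℝ (Set.extremePoints ℝ P) = P := by
  rw [← (hPpoly.isCompact_convexHull ℝ).isClosed.closure_eq]
  exact closure_convexHull_extremePoints hPc hPv

lemma e_cover (hdim : Module.finrank ℝ V = 2) (ω : V →ₗ[ℝ] V →ₗ[ℝ] ℝ)
    (halt : ∀ x : V, ω x x = 0)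
    (hnd : ∀ a : V, (∀ y : V, ω a y = 0) → a = 0)
    (P : Set V) (hPc : IsCompact P) (hPv : Convex ℝ P) (hPi : (interior P).Nonempty)
    (hPpoly : (Set.extremePoints ℝ P).Finite)
    (x : V) (hx : x ∈ frontier P) : ∃ e, IsPEdge ω P e ∧ x ∈ segment ℝ e.1 e.2 := by
  suffices h : ∃ a b u : V, u ≠ 0 ∧ a ∈ Set.extremePoints ℝ P ∧ b ∈ Set.extremePoints ℝ P ∧ a ≠ b ∧
      (∀ y ∈ P, 0 ≤ ω u (y - a)) ∧ ω u (b - a) = 0 ∧ x ∈ segment ℝ a b by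
    obtain ⟨a, b, u, hu, ha, hb, hab, hy, h0, hx⟩ := h
    rcases e_mk hdim ω halt hnd P u a b hu ha hb hab hy h0 with h | h
    · exact ⟨_, h, hx⟩
    · exact ⟨_, h, by rw [segment_symm]; exact hx⟩
  have hxP : x ∈ P := hPc.isClosed.frontier_subset hx
  obtain ⟨u, hu, hsup⟩ := h_support hdim ω hnd P hPc hPv hPi x hx
  have : ∃ w, ω u w ≠ 0 := by
    by_contra! hc
    exact hu (hnd u hc)
  obtain ⟨w, hw⟩ := this
  have hpar : ∀ p, ω u p = 0 → ω w p = 0 → p = 0 := by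
    intro p h1 h2
    have := h_decomp hdim ω halt u w p hw
    rw [h1, h_anti ω halt w p, h2] at this
    simpa [hw] using this
  -- the face
  set F : Set V := {y | y ∈ P ∧ ω u (y - x) = 0} with hF
  have hFc : IsCompact F := by
    apply hPc.of_isClosed_subset _ (fun y hy => hy.1)
    exact hPc.isClosed.inter (isClosed_eq ((h_cont hdim ω u).comp (continuous_id.sub continuous_const)) continuous_const)
  have hxF : x ∈ F := ⟨hxP, by simp⟩
  have hext : ∀ ε : ℝ, ε ≠ 0 → ∀ a ∈ F, (∀ y ∈ F, ε * ω w a ≤ ε * ω w y) → a ∈ Set.extremePoints ℝ P := by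
    intro ε hε a ha hmin
    rw [mem_extremePoints]
    refine ⟨ha.1, fun p hp q hq hpq => ?_⟩
    obtain ⟨s, t, hs, ht, hst, rfl⟩ := hpq
    have h1 := ha.2
    have e1 : s • p + t • q - x = s • (p - x) + t • (q - x) := by
      rw [show t = 1 - s by linarith]; module
    rw [e1, map_add, map_smul, map_smul, smul_eq_mul, smul_eq_mul] at h1
    have j1 := mul_nonneg hs.le (hsup p hp)
    have j2 := mul_nonneg ht.le (hsup q hq)
    have z1 : ω u (p - x) = 0 := (mul_eq_zero.1 (show s * ω u (p - x) = 0 by linarith)).resolve_left hs.ne'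
    have z2 : ω u (q - x) = 0 := (mul_eq_zero.1 (show t * ω u (q - x) = 0 by linarith)).resolve_left ht.ne'
    have k1 := hmin p ⟨hp, z1⟩
    have k2 := hmin q ⟨hq, z2⟩
    simp only [map_add, map_smul, smul_eq_mul] at k1 k2
    have hpq : p = q := by
      apply sub_eq_zero.1
      apply hpar
      · rw [← sub_sub_sub_cancel_right p q x, map_sub, z1, z2, sub_zero]
      · rw [map_sub]
        have ht' : t = 1 - s := by linarith
        have : ε * (ω w p - ω w q) = 0 := by
          subst ht'
          have a1 : (1 - s) * (ε * (ω w q - ω w p)) ≤ 0 := by linarith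
          have a2 : s * (ε * (ω w p - ω w q)) ≤ 0 := by linarith
          have b1 := nonpos_of_mul_nonpos_right a1 ht
          have b2 := nonpos_of_mul_nonpos_right a2 hs
          linarith
        exact (mul_eq_zero.1 this).resolve_left hε
    subst hpq
    rw [← add_smul, hst, one_smul]
    simp
  obtain ⟨a, haF, hamin⟩ := hFc.exists_isMinOn ⟨x, hxF⟩ (h_cont hdim ω w).continuousOn
  obtain ⟨b, hbF, hbmax⟩ := hFc.exists_isMaxOn ⟨x, hxF⟩ (h_cont hdim ω w).continuousOn
  have haE := hext 1 one_ne_zero a haF (fun y hy => by simpa using hamin hy)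
  have hbE := hext (-1) (by norm_num) b hbF (fun y hy => by simpa using hbmax hy)
  by_cases hab : a = b
  · -- the face is the single point x
    have hFx : ∀ y ∈ F, y = x := by
      have : ∀ y ∈ F, y = a := by
        intro y hy
        apply sub_eq_zero.1
        apply hpar
        · rw [← sub_sub_sub_cancel_right y a x, map_sub, hy.2, haF.2, sub_zero]
        · rw [map_sub]
          have h1 : ω w a ≤ ω w y := hamin hy
          have h2 : ω w y ≤ ω w b := hbmax hy
          rw [← hab] at h2
          linarith
      intro y hy
      rw [this y hy, this x hxF]
    have hxa : a = x := hFx a haF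
    rw [hxa] at haE
    have hEpos : ∀ y ∈ P, y ≠ x → 0 < ω u (y - x) := by
      intro y hy hne
      rcases (hsup y hy).lt_or_eq with h | h
      · exact h
      · exact absurd (hFx y ⟨hy, h.symm⟩) hne
    have hEne : (Set.extremePoints ℝ P \ {x}).Nonempty := by
      by_contra hc
      rw [Set.not_nonempty_iff_eq_empty, Set.sdiff_eq_empty] at hc
      have h1 : P ⊆ {x} := by
        rw [← e_hull P hPc hPv hPpoly]
        exact (convexHull_mono hc).trans (by rw [convexHull_singleton])
      obtain ⟨q, hq⟩ := hPi
      have h2 := h_pos hdim ω hnd P u x q hu hsup hq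
      rw [h1 (interior_subset hq)] at h2
      simp at h2
    obtain ⟨y, hyE, hymin⟩ := Set.exists_min_image _ (fun y => ω w (y - x) / ω u (y - x)) (hPpoly.subset Set.sdiff_subset : (Set.extremePoints ℝ P \ {x}).Finite) hEne
    have hyx : y ≠ x := hyE.2
    have huy := hEpos y hyE.1.1 hyx
    set m := ω w (y - x) / ω u (y - x) with hm
    refine ⟨x, y, w - m • u, ?_, haE, hyE.1, hyx.symm, ?_, ?_, left_mem_segment ℝ x y⟩
    · intro hc
      have : w = m • u := sub_eq_zero.1 hc
      rw [this, map_smul, halt, smul_zero] at hw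
      exact hw rfl
    · have : P ⊆ {z | 0 ≤ ω (w - m • u) (z - x)} := by
        conv_lhs => rw [← e_hull P hPc hPv hPpoly]
        apply convexHull_min
        · intro z hz
          simp only [Set.mem_ofPred_eq]
          by_cases hzx : z = x
          · simp [hzx]
          · have h1 := hymin z ⟨hz, hzx⟩
            rw [le_div_iff₀ (hEpos z hz.1 hzx)] at h1
            rw [map_sub ω, LinearMap.sub_apply, map_smul, LinearMap.smul_apply, smul_eq_mul]
            linarith
        · have e : {z | 0 ≤ ω (w - m • u) (z - x)} = {z | ω (w - m • u) x ≤ ω (w - m • u) z} := by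
            ext z
            simp only [Set.mem_ofPred_eq]
            rw [map_sub (ω (w - m • u)), sub_nonneg]
          rw [e]
          exact convex_halfSpace_ge (ω (w - m • u)).isLinear _
      exact this
    · rw [map_sub ω, LinearMap.sub_apply, map_smul, LinearMap.smul_apply, smul_eq_mul, hm, div_mul_cancel₀ _ huy.ne', sub_self]
  · have hua : ∀ y, ω u (y - a) = ω u (y - x) := by
      intro y
      rw [← sub_sub_sub_cancel_right y a x, map_sub, haF.2, sub_zero]
    refine ⟨a, b, u, hu, haE, hbE, hab, fun y hy => by rw [hua]; exact hsup y hy, by rw [hua]; exact hbF.2, ?_⟩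
    have h1 : ω w a ≤ ω w x := hamin hxF
    have h2 : ω w x ≤ ω w b := hbmax hxF
    have h3 : ω w a ≠ ω w b := by
      intro h
      apply hab
      apply Eq.symm
      apply sub_eq_zero.1
      apply hpar
      · rw [hua, hbF.2]
      · rw [map_sub, h, sub_self]
    have h4 : 0 < ω w b - ω w a := by
      rcases (h1.trans h2).lt_or_eq with h | h
      · linarith
      · exact absurd h h3
    rw [segment_eq_image']
    refine ⟨(ω w x - ω w a) / (ω w b - ω w a), ⟨by apply div_nonneg <;> linarith, by rw [div_le_one] <;> linarith⟩, ?_⟩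
    apply sub_eq_zero.1
    apply hpar
    · have : ∀ s : ℝ, a + s • (b - a) - x = (a - x) + s • (b - a) := fun s => by module
      rw [this, map_add, haF.2, map_smul, hua, hbF.2, smul_zero, add_zero]
    · simp only [map_add, map_sub, map_smul, smul_eq_mul]
      rw [div_mul_cancel₀ _ h4.ne']; ring

end edges

section area
variable {V : Type*} [NormedAddCommGroup V] [NormedSpace ℝ V]

lemma r_hit (P : Set V) (hPc : IsCompact P) (c p : V) (hp : p ∈ P) (hpc : p ≠ c) :
    ∃ x ∈ frontier P, p ∈ segment ℝ c x := by
  have hd : 0 < ‖p - c‖ := norm_pos_iff.2 (sub_ne_zero.2 hpc)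
  obtain ⟨R, hR⟩ := hPc.isBounded.subset_closedBall c
  have hcont : Continuous (fun s : ℝ => c + s • (p - c)) := by fun_prop
  have hS : IsCompact (Set.Icc 1 (R / ‖p - c‖) ∩ (fun s : ℝ => c + s • (p - c)) ⁻¹' P) :=
    isCompact_Icc.inter_right (hPc.isClosed.preimage hcont)
  have hmem : ∀ s : ℝ, 1 ≤ s → c + s • (p - c) ∈ P →
      s ∈ (Set.Icc 1 (R / ‖p - c‖) ∩ (fun s : ℝ => c + s • (p - c)) ⁻¹' P) := by
    intro s hs hsP
    refine ⟨⟨hs, ?_⟩, hsP⟩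
    have := hR hsP
    rw [Metric.mem_closedBall, dist_eq_norm, add_sub_cancel_left, norm_smul, Real.norm_eq_abs,
      abs_of_pos (by linarith)] at this
    rwa [le_div_iff₀ hd]
  obtain ⟨s, hs, hmax⟩ := hS.exists_isMaxOn ⟨1, hmem 1 le_rfl (by simpa using hp)⟩ continuousOn_id
  have hs1 : 1 ≤ s := hs.1.1
  refine ⟨c + s • (p - c), ⟨subset_closure hs.2, fun hi => ?_⟩, ?_⟩
  · have h0 : ∀ᶠ t in nhds s, c + t • (p - c) ∈ P :=
      hcont.continuousAt (mem_interior_iff_mem_nhds.1 hi)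
    obtain ⟨ε, hε, hb⟩ := Metric.eventually_nhds_iff.1 h0
    have h1 := hb (y := s + ε / 2) (by rw [Real.dist_eq, add_sub_cancel_left, abs_of_pos (by positivity)]; linarith)
    have h2 : s + ε / 2 ≤ s := hmax (hmem _ (by linarith) h1)
    linarith
  · rw [segment_eq_image']
    refine ⟨1 / s, ⟨by positivity, by rw [div_le_one] <;> linarith⟩, ?_⟩
    have : s ≠ 0 := by linarith
    match_scalars <;> field_simp <;> ring

lemma r_uniq_aux (P : Set V) (hPv : Convex ℝ P) (hPc : IsClosed P) (c x x' : V) (hc : c ∈ interior P)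
    (hx : x ∈ frontier P) (hx' : x' ∈ frontier P) (s s' : ℝ) (hs : 0 < s) (hss : s ≤ s')
    (h : s • (x - c) = s' • (x' - c)) : x = x' := by
  have hs' : 0 < s' := by linarith
  have e1 : x' = c + (s / s') • (x - c) := by
    have : (s / s') • (x - c) = x' - c := by
      rw [div_eq_inv_mul, mul_smul, h, smul_smul, inv_mul_cancel₀ hs'.ne', one_smul]
    rw [this]; abel
  rcases hss.lt_or_eq with h1 | h1
  · exfalso
    apply hx'.2
    apply hPv.openSegment_interior_self_subset_interior hc (hPc.frontier_subset hx)
    rw [openSegment_eq_image']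
    exact ⟨s / s', ⟨by positivity, by rw [div_lt_one] <;> linarith⟩, e1.symm⟩
  · rw [← h1, div_self hs.ne', one_smul] at e1
    rw [e1]; abel

lemma r_uniq (P : Set V) (hPv : Convex ℝ P) (hPc : IsClosed P) (c x x' p : V) (hc : c ∈ interior P)
    (hx : x ∈ frontier P) (hx' : x' ∈ frontier P) (hp : p ≠ c) (h : p ∈ segment ℝ c x)
    (h' : p ∈ segment ℝ c x') : x = x' := by
  rw [segment_eq_image'] at h h'
  obtain ⟨s, ⟨hs, -⟩, rfl⟩ := h
  obtain ⟨s', ⟨hs', -⟩, e⟩ := h'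
  simp only [add_right_inj] at e
  have hs0 : s ≠ 0 := by rintro rfl; simp at hp
  have hs0' : s' ≠ 0 := by
    rintro rfl
    rw [zero_smul] at e
    simp [← e] at hp
  rcases le_total s s' with h | h
  · exact r_uniq_aux P hPv hPc c x x' hc hx hx' s s' (lt_of_le_of_ne hs hs0.symm) h e.symm
  · exact (r_uniq_aux P hPv hPc c x' x hc hx' hx s' s (lt_of_le_of_ne hs' hs0'.symm) h e).symm

variable [MeasurableSpace V] [BorelSpace V]

lemma m_seg (ω : V →ₗ[ℝ] V →ₗ[ℝ] ℝ) (μ : Measure V) [μ.IsAddHaarMeasure]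
    (hμω : ∀ x y : V,
      μ (Set.image2 (fun s t : ℝ => s • x + t • y) (Set.Icc 0 1) (Set.Icc 0 1)) =
        ENNReal.ofReal |ω x y|) (c v : V) : μ (segment ℝ c v) = 0 := by
  have h := hμω (v - c) 0
  rw [map_zero, abs_zero, ENNReal.ofReal_zero] at h
  rw [← measure_preimage_add μ (-c)] at h
  refine measure_mono_null ?_ h
  rw [segment_eq_image']
  rintro _ ⟨t, ht, rfl⟩
  exact ⟨t, ht, 0, by simp, by simp⟩

lemma m_tri (hdim : Module.finrank ℝ V = 2) (ω : V →ₗ[ℝ] V →ₗ[ℝ] ℝ) (μ : Measure V) [μ.IsAddHaarMeasure]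
    (halt : ∀ x : V, ω x x = 0)
    (hμω : ∀ x y : V,
      μ (Set.image2 (fun s t : ℝ => s • x + t • y) (Set.Icc 0 1) (Set.Icc 0 1)) =
        ENNReal.ofReal |ω x y|) (c a b : V) (hab : ω (a - c) (b - c) ≠ 0) :
    2 * μ (convexHull ℝ {c, a, b}) = ENNReal.ofReal |ω (a - c) (b - c)| := by
  have : FiniteDimensional ℝ V := Module.finite_of_finrank_pos (by omega)
  set T := convexHull ℝ {c, a, b} with hT
  have hTc : IsCompact T := Set.Finite.isCompact_convexHull ℝ (by simp)
  have hTm : ∀ p, p ∈ T ↔ ∃ s t : ℝ, 0 ≤ s ∧ 0 ≤ t ∧ s + t ≤ 1 ∧ p = c + s • (a - c) + t • (b - c) := by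
    intro p
    rw [hT, ← convexJoin_singleton_segment, mem_convexJoin]
    constructor
    · rintro ⟨_, rfl, x, hx, hp⟩
      rw [segment_eq_image'] at hx hp
      obtain ⟨t, ht, rfl⟩ := hx
      obtain ⟨s, hs, rfl⟩ := hp
      refine ⟨s * (1 - t), s * t, mul_nonneg hs.1 (by linarith [ht.2]), mul_nonneg hs.1 ht.1, by linarith [hs.2], ?_⟩
      module
    · rintro ⟨s, t, hs, ht, hst, rfl⟩
      refine ⟨c, rfl, ?_⟩
      by_cases h0 : s + t = 0
      · have : s = 0 := by linarith
        have : t = 0 := by linarith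
        subst s t
        exact ⟨a, left_mem_segment _ _ _, by simpa using left_mem_segment ℝ c a⟩
      · have hp : 0 < s + t := by positivity
        refine ⟨a + (t / (s + t)) • (b - a), ?_, ?_⟩
        · rw [segment_eq_image']
          exact ⟨t / (s + t), ⟨by positivity, by rw [div_le_one] <;> linarith⟩, rfl⟩
        · rw [segment_eq_image']
          refine ⟨s + t, ⟨hp.le, hst⟩, ?_⟩
          match_scalars <;> field_simp <;> ring
  -- reflected triangle
  set T' : Set V := (fun p => (a + b) - p) ⁻¹' T with hT'
  have hμT' : μ T' = μ T := by
    have e : T' = (fun p => (-1 : ℝ) • p) ⁻¹' ((fun q => (a + b) + q) ⁻¹' T) := by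
      ext p
      simp [hT', sub_eq_add_neg]
    rw [e, Measure.addHaar_preimage_smul μ (by norm_num), measure_preimage_add]
    simp [hdim]
  have hun : T ∪ T' = (fun h => -c + h) ⁻¹' (Set.image2 (fun s t : ℝ => s • (a - c) + t • (b - c)) (Set.Icc 0 1) (Set.Icc 0 1)) := by
    ext p
    rw [Set.mem_union, hT', Set.mem_preimage, Set.mem_preimage, hTm, hTm]
    constructor
    · rintro (⟨s, t, hs, ht, hst, rfl⟩ | ⟨s, t, hs, ht, hst, h⟩)
      · exact ⟨s, ⟨hs, by linarith⟩, t, ⟨ht, by linarith⟩, by module⟩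
      · refine ⟨1 - s, ⟨by linarith, by linarith⟩, 1 - t, ⟨by linarith, by linarith⟩, ?_⟩
        have : p = a + b - (c + s • (a - c) + t • (b - c)) := by rw [← h]; abel
        rw [this]
        module
    · rintro ⟨s, hs, t, ht, h⟩
      have hp : p = c + s • (a - c) + t • (b - c) := by
        simp only at h
        rw [add_assoc, h]; abel
      rcases le_total (s + t) 1 with h1 | h1
      · left
        exact ⟨s, t, hs.1, ht.1, h1, hp⟩
      · right
        refine ⟨1 - s, 1 - t, by linarith [hs.2], by linarith [ht.2], by linarith, ?_⟩
        rw [hp]; module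
  have hdis : AEDisjoint μ T T' := by
    refine measure_mono_null ?_ (m_seg ω μ hμω a b)
    rintro p ⟨h1, h2⟩
    rw [hTm] at h1
    rw [hT', Set.mem_preimage, hTm] at h2
    obtain ⟨s, t, hs, ht, hst, rfl⟩ := h1
    obtain ⟨s', t', hs', ht', hst', h⟩ := h2
    have h3 : (1 - s - s') • (a - c) + (1 - t - t') • (b - c) = 0 := by
      rw [← sub_eq_zero] at h
      rw [← h]; module
    have z1 : 1 - s - s' = 0 := by
      have := congrArg (fun v => ω v (b - c)) h3
      simp only [map_add, LinearMap.add_apply, map_smul, LinearMap.smul_apply, halt, smul_eq_mul, map_zero, LinearMap.zero_apply, mul_zero, add_zero] at this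
      exact (mul_eq_zero.1 this).resolve_right hab
    have z2 : 1 - t - t' = 0 := by
      have := congrArg (fun v => ω (a - c) v) h3
      simp only [map_add, map_smul, halt, smul_eq_mul, map_zero, mul_zero, zero_add] at this
      exact (mul_eq_zero.1 this).resolve_right hab
    rw [segment_eq_image']
    refine ⟨t, ⟨ht, by linarith⟩, ?_⟩
    have : s = 1 - t := by linarith
    rw [this]; module
  have hm : MeasurableSet T' := by
    apply IsClosed.measurableSet
    exact hTc.isClosed.preimage (by fun_prop)
  rw [← hμω, ← measure_preimage_add μ (-c) (Set.image2 _ _ _), ← hun, measure_union₀ hm.nullMeasurableSet hdis, hμT', two_mul]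

end area

section main
variable {V : Type*} [NormedAddCommGroup V] [NormedSpace ℝ V]

lemma e_finite (ω : V →ₗ[ℝ] V →ₗ[ℝ] ℝ) (P : Set V)
    (hPpoly : (Set.extremePoints ℝ P).Finite) : {e | IsPEdge ω P e}.Finite :=
  (hPpoly.prod hPpoly).subset (fun _ he => ⟨he.1, he.2.1⟩)

lemma e_tri_eq (ω : V →ₗ[ℝ] V →ₗ[ℝ] ℝ) (halt : ∀ x : V, ω x x = 0) (a b c : V) :
    ω (a - c) (b - c) = ω (b - a) (c - a) := by
  have h := h_anti ω halt
  simp only [map_sub, LinearMap.sub_apply, halt]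
  rw [h a b, h b c]
  ring

variable [MeasurableSpace V] [BorelSpace V]

lemma m_front (hdim : Module.finrank ℝ V = 2) (ω : V →ₗ[ℝ] V →ₗ[ℝ] ℝ)
    (halt : ∀ x : V, ω x x = 0)
    (hnd : ∀ a : V, (∀ y : V, ω a y = 0) → a = 0)
    (P : Set V) (hPc : IsCompact P) (hPv : Convex ℝ P) (hPi : (interior P).Nonempty)
    (hPpoly : (Set.extremePoints ℝ P).Finite) (S : Finset (V × V)) (hS : ∀ e, e ∈ S ↔ IsPEdge ω P e) :
    (μH[1] (frontier P)).toReal = ∑ e ∈ S, ‖e.2 - e.1‖ := by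
  have e1 : frontier P = ⋃ e ∈ S, segment ℝ e.1 e.2 := by
    apply Set.Subset.antisymm
    · intro x hx
      obtain ⟨e, he, hxe⟩ := e_cover hdim ω halt hnd P hPc hPv hPi hPpoly x hx
      exact Set.mem_biUnion ((hS e).2 he) hxe
    · apply Set.iUnion₂_subset
      intro e he
      exact e_front hdim ω halt hnd P hPv e.1 e.2 ((hS e).1 he)
  have : NullSingletonClass (μH[1] : Measure V) := Measure.nullSingletonClass_hausdorff V one_pos
  rw [e1, measure_biUnion_finset₀, ENNReal.toReal_sum]
  · apply Finset.sum_congr rfl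
    intro e _
    rw [hausdorffMeasure_segment, edist_dist, ENNReal.toReal_ofReal dist_nonneg, dist_comm, dist_eq_norm]
  · intro e _
    rw [hausdorffMeasure_segment]
    exact edist_ne_top _ _
  · intro e he e' he' hne
    exact measure_mono_null (e_disj hdim ω halt hnd P hPi e e' ((hS e).1 he) ((hS e').1 he') hne)
      (hPpoly.countable.measure_zero _)
  · intro e _
    apply MeasurableSet.nullMeasurableSet
    apply IsClosed.measurableSet
    rw [← convexHull_pair]
    exact ((Set.toFinite _).isCompact_convexHull ℝ).isClosed

lemma m_P (hdim : Module.finrank ℝ V = 2) (ω : V →ₗ[ℝ] V →ₗ[ℝ] ℝ)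
    (halt : ∀ x : V, ω x x = 0)
    (hnd : ∀ a : V, (∀ y : V, ω a y = 0) → a = 0)
    (μ : Measure V) [μ.IsAddHaarMeasure]
    (hμω : ∀ x y : V,
      μ (Set.image2 (fun s t : ℝ => s • x + t • y) (Set.Icc 0 1) (Set.Icc 0 1)) =
        ENNReal.ofReal |ω x y|)
    (P : Set V) (hPc : IsCompact P) (hPv : Convex ℝ P) (hPi : (interior P).Nonempty)
    (hPpoly : (Set.extremePoints ℝ P).Finite) (S : Finset (V × V)) (hS : ∀ e, e ∈ S ↔ IsPEdge ω P e)
    (c : V) (hc : c ∈ interior P) :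
    2 * (μ P).toReal = ∑ e ∈ S, ω (e.2 - e.1) (c - e.1) := by
  have hcP : c ∈ P := interior_subset hc
  have hcov : ∀ p ∈ P, p ≠ c → ∃ e ∈ S, ∃ x ∈ segment ℝ e.1 e.2, p ∈ segment ℝ c x := by
    intro p hp hpc
    obtain ⟨x, hx, hpx⟩ := r_hit P hPc c p hp hpc
    obtain ⟨e, he, hxe⟩ := e_cover hdim ω halt hnd P hPc hPv hPi hPpoly x hx
    exact ⟨e, (hS e).2 he, x, hxe, hpx⟩
  have hTm : ∀ e : V × V, ∀ p, p ∈ convexHull ℝ {c, e.1, e.2} ↔ ∃ x ∈ segment ℝ e.1 e.2, p ∈ segment ℝ c x := by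
    intro e p
    rw [← convexJoin_singleton_segment, mem_convexJoin]
    simp
  have e1 : P = ⋃ e ∈ S, convexHull ℝ {c, e.1, e.2} := by
    apply Set.Subset.antisymm
    · intro p hp
      by_cases hpc : p = c
      · have : ∃ q ∈ P, q ≠ c := by
          have : Nontrivial V := Module.nontrivial_of_finrank_pos (R := ℝ) (by omega)
          by_contra! h
          have h1 : P ⊆ {c} := h
          have h2 := interior_mono h1 hc
          rw [interior_singleton] at h2
          exact h2
        obtain ⟨q, hq, hqc⟩ := this
        obtain ⟨e, he, -⟩ := hcov q hq hqc
        refine Set.mem_biUnion he (subset_convexHull ℝ _ ?_)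
        simp [hpc]
      · obtain ⟨e, he, h⟩ := hcov p hp hpc
        exact Set.mem_biUnion he ((hTm e p).2 h)
    · apply Set.iUnion₂_subset
      intro e he
      have h := (hS e).1 he
      apply convexHull_min _ hPv
      intro z hz
      simp only [Set.mem_insert_iff, Set.mem_singleton_iff] at hz
      rcases hz with rfl | rfl | rfl
      · exact hcP
      · exact h.1.1
      · exact h.2.1.1
  have hpos : ∀ e ∈ S, 0 < ω (e.1 - c) (e.2 - c) := by
    intro e he
    have h := (hS e).1 he
    rw [e_tri_eq ω halt]
    exact h_pos hdim ω hnd P _ _ c (sub_ne_zero.2 h.2.2.1.symm) h.2.2.2 hc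
  have hcpt : ∀ e : V × V, IsCompact (convexHull ℝ {c, e.1, e.2}) := fun e =>
    (Set.toFinite _).isCompact_convexHull ℝ
  have e2 : μ P = ∑ e ∈ S, μ (convexHull ℝ {c, e.1, e.2}) := by
    conv_lhs => rw [e1]
    apply measure_biUnion_finset₀
    · intro e he e' he' hne
      have hnull : μ (⋃ v ∈ Set.extremePoints ℝ P, segment ℝ c v) = 0 :=
        (measure_biUnion_null_iff hPpoly.countable).2 (fun v _ => m_seg ω μ hμω c v)
      have h := (hS e).1 he
      have h' := (hS e').1 he'
      refine measure_mono_null ?_ hnull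
      rintro p ⟨hp, hp'⟩
      obtain ⟨x, hx, hpx⟩ := (hTm e p).1 hp
      obtain ⟨x', hx', hpx'⟩ := (hTm e' p).1 hp'
      by_cases hpc : p = c
      · rw [hpc]
        exact Set.mem_biUnion h.1 (left_mem_segment ℝ c _)
      · have := r_uniq P hPv hPc.isClosed c x x' p hc
          (e_front hdim ω halt hnd P hPv e.1 e.2 h hx) (e_front hdim ω halt hnd P hPv e'.1 e'.2 h' hx') hpc hpx hpx'
        subst this
        exact Set.mem_biUnion (e_disj hdim ω halt hnd P hPi e e' h h' hne ⟨hx, hx'⟩) hpx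
    · intro e _
      exact (hcpt e).isClosed.measurableSet.nullMeasurableSet
  rw [e2, ENNReal.toReal_sum (fun e _ => (hcpt e).measure_ne_top), Finset.mul_sum]
  apply Finset.sum_congr rfl
  intro e he
  have h := congrArg ENNReal.toReal (m_tri hdim ω μ halt hμω c e.1 e.2 (hpos e he).ne')
  rw [ENNReal.toReal_mul, ENNReal.toReal_ofReal (abs_nonneg _), abs_of_pos (hpos e he)] at h
  rw [← e_tri_eq ω halt, ← h]
  simp

end main
/-- For a convex polygon `P` containing the anticircle `D` of radius `ρ` centred at `c`,
`ρ · L(∂P) ≤ 2 · area(P)`, where the perimeter `L(∂P)` is the one-dimensional Hausdorff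
measure (w.r.t. the norm metric) of the boundary of `P`; equality holds iff `P` is
circumscribed about the anticircle, i.e. every boundary point of `P` lies on a supporting
line of `P` that touches `D`. -/
theorem stmt15 {V : Type*} [NormedAddCommGroup V] [NormedSpace ℝ V]
    [MeasurableSpace V] [BorelSpace V]
    (hdim : Module.finrank ℝ V = 2)
    (ω : V →ₗ[ℝ] V →ₗ[ℝ] ℝ)
    (halt : ∀ x : V, ω x x = 0)
    (hnd : ∀ a : V, (∀ y : V, ω a y = 0) → a = 0)
    (μ : Measure V) [μ.IsAddHaarMeasure]
    (hμω : ∀ x y : V,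
      μ (Set.image2 (fun s t : ℝ => s • x + t • y) (Set.Icc 0 1) (Set.Icc 0 1)) =
        ENNReal.ofReal |ω x y|)
    (P : Set V) (hPc : IsCompact P) (hPv : Convex ℝ P) (hPi : (interior P).Nonempty)
    (hPpoly : (Set.extremePoints ℝ P).Finite)
    (ρ : ℝ) (hρ : 0 < ρ) (c : V)
    (hD : {x : V | anorm ω (x - c) ≤ ρ} ⊆ P) :
    ρ * (μH[1] (frontier P)).toReal ≤ 2 * (μ P).toReal ∧
    (ρ * (μH[1] (frontier P)).toReal = 2 * (μ P).toReal ↔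
      ∀ x ∈ frontier P, ∃ φ : V →L[ℝ] ℝ, φ ≠ 0 ∧ (∀ y ∈ P, φ y ≤ φ x) ∧
        ∃ z : V, anorm ω (z - c) ≤ ρ ∧ φ z = φ x) := by

  have hc : c ∈ interior P := h_int hdim ω P ρ hρ c hD
  obtain ⟨S, hS⟩ : ∃ S : Finset (V × V), ∀ e, e ∈ S ↔ IsPEdge ω P e :=
    ⟨(e_finite ω P hPpoly).toFinset, fun e => by simp⟩
  rw [m_front hdim ω halt hnd P hPc hPv hPi hPpoly S hS,
    m_P hdim ω halt hnd μ hμω P hPc hPv hPi hPpoly S hS c hc, Finset.mul_sum]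
  have hle : ∀ e ∈ S, ρ * ‖e.2 - e.1‖ ≤ ω (e.2 - e.1) (c - e.1) := by
    intro e he
    have h := (hS e).1 he
    obtain ⟨z, hz, hzw⟩ := h_att hdim ω hnd ρ hρ (e.2 - e.1)
    have h1 := h.2.2.2 (c + z) (hD (by simpa using hz))
    rw [add_sub_right_comm, map_add, h_anti ω halt z, hzw] at h1
    linarith
  refine ⟨Finset.sum_le_sum hle, ?_⟩
  rw [Finset.sum_eq_sum_iff_of_le hle]
  constructor
  · intro heq x hx
    obtain ⟨e, he, hxe⟩ := e_cover hdim ω halt hnd P hPc hPv hPi hPpoly x hx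
    have h1 := heq e ((hS e).2 he)
    have hne : e.2 - e.1 ≠ 0 := sub_ne_zero.2 he.2.2.1.symm
    have hfd : FiniteDimensional ℝ V := Module.finite_of_finrank_pos (by omega)
    obtain ⟨z, hz, hzw⟩ := h_att hdim ω hnd ρ hρ (e.2 - e.1)
    have hx0 : ω (e.2 - e.1) x = ω (e.2 - e.1) e.1 := by
      rw [segment_eq_image'] at hxe
      obtain ⟨t, ht, rfl⟩ := hxe
      simp only [map_add (ω (e.2 - e.1)), map_smul, halt, smul_zero, add_zero]
    refine ⟨-(LinearMap.toContinuousLinearMap (ω (e.2 - e.1))), ?_, ?_, c + z, by simpa using hz, ?_⟩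
    · intro h0
      apply hne
      apply hnd
      intro y
      have h00 : -(ω (e.2 - e.1) y) = 0 := congrArg (fun f : V →L[ℝ] ℝ => f y) h0
      linarith
    · intro y hy
      have h2 := he.2.2.2 y hy
      rw [map_sub (ω (e.2 - e.1)), ← hx0] at h2
      change -(ω (e.2 - e.1) y) ≤ -(ω (e.2 - e.1) x)
      linarith
    · change -(ω (e.2 - e.1) (c + z)) = -(ω (e.2 - e.1) x)
      rw [map_sub (ω (e.2 - e.1))] at h1
      rw [hx0, map_add (ω (e.2 - e.1)), h_anti ω halt z, hzw]
      linarith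
  · intro H e he
    apply le_antisymm (hle e he)
    have h := (hS e).1 he
    have hne : e.2 - e.1 ≠ 0 := sub_ne_zero.2 h.2.2.1.symm
    set m : V := e.1 + (1 / 2 : ℝ) • (e.2 - e.1) with hm
    have hms : m ∈ segment ℝ e.1 e.2 := by
      rw [segment_eq_image']
      exact ⟨1 / 2, ⟨by norm_num, by norm_num⟩, rfl⟩
    obtain ⟨φ, hφ, hsup, z, hz, hzm⟩ := H m (e_front hdim ω halt hnd P hPv e.1 e.2 h hms)
    obtain ⟨u, hu⟩ := h_repr hdim ω hnd φ
    have hu0 : u ≠ 0 := by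
      rintro rfl
      apply hφ
      ext y
      simp [hu]
    have h1 := hsup e.1 h.1.1
    have h2 := hsup e.2 h.2.1.1
    have h3 : φ (e.2 - e.1) = 0 := by
      rw [hm] at h1 h2
      simp only [map_add, map_smul, map_sub, smul_eq_mul] at h1 h2 ⊢
      linarith
    rw [hu] at h3
    obtain ⟨k, hk⟩ := h_par hdim ω halt hnd u _ hu0 h3
    have h4 : ω u (z - m) = 0 := by rw [← hu, map_sub, hzm, sub_self]
    have h5 : ω (e.2 - e.1) (z - m) = 0 := by
      rw [hk, map_smul, LinearMap.smul_apply, h4, smul_zero]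
    have h6 : ω (e.2 - e.1) (m - e.1) = 0 := by
      rw [hm, add_sub_cancel_left, map_smul, halt, smul_zero]
    have h7 : c - e.1 = (z - m) + (m - e.1) - (z - c) := by abel
    rw [h7, map_sub (ω (e.2 - e.1)), map_add (ω (e.2 - e.1)), h5, h6]
    have h8 := h_ge hdim ω (z - c) (e.2 - e.1)
    have h9 := mul_le_mul_of_nonneg_right hz (norm_nonneg (e.2 - e.1))
    rw [h_anti ω halt (z - c)]
    linarith
end

section
/- The perimeter of an anticircle of radius ρ, measured in the norm, satisfies ρ·L(ρ∂I) = 2·area(ρI), where I is the unit ball of the antinorm. -/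
set_option linter.unusedSectionVars false
open MeasureTheory Pointwise

section anti
variable {V : Type*} [NormedAddCommGroup V] [NormedSpace ℝ V]

lemma anti_eq [FiniteDimensional ℝ V] [Nontrivial V] (ω : V →ₗ[ℝ] V →ₗ[ℝ] ℝ) (x : V) :
    anorm ω x = ‖LinearMap.toContinuousLinearMap (ω x)‖ := by
  have hub : ∀ r ∈ {r : ℝ | ∃ y : V, ‖y‖ = 1 ∧ r = ω x y},
      r ≤ ‖LinearMap.toContinuousLinearMap (ω x)‖ := by
    rintro r ⟨y, hy, rfl⟩
    have := (LinearMap.toContinuousLinearMap (ω x)).le_opNorm y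
    rw [hy, mul_one] at this
    exact (le_abs_self _).trans this
  have hbdd : BddAbove {r : ℝ | ∃ y : V, ‖y‖ = 1 ∧ r = ω x y} := ⟨_, hub⟩
  obtain ⟨y₀, hy₀⟩ := exists_norm_eq V (zero_le_one (α := ℝ))
  have hle : ∀ y : V, ‖y‖ = 1 → |ω x y| ≤ anorm ω x := by
    intro y hy
    rw [abs_le']
    refine ⟨le_csSup hbdd ⟨y, hy, rfl⟩, le_csSup hbdd ⟨-y, by simpa using hy, by simp⟩⟩
  apply le_antisymm
  · exact csSup_le ⟨_, y₀, hy₀, rfl⟩ hub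
  · refine ContinuousLinearMap.opNorm_le_bound _ ((abs_nonneg _).trans (hle y₀ hy₀)) ?_
    intro y
    rcases eq_or_ne y 0 with rfl | hy
    · simp
    have hn : ‖y‖ ≠ 0 := norm_ne_zero_iff.mpr hy
    have h := hle (‖y‖⁻¹ • y) (by rw [norm_smul, norm_inv, norm_norm, inv_mul_cancel₀ hn])
    rw [map_smul, smul_eq_mul, abs_mul, abs_inv, abs_norm, inv_mul_le_iff₀ (by positivity)] at h
    simpa [mul_comm] using h

variable [FiniteDimensional ℝ V] [Nontrivial V] (ω : V →ₗ[ℝ] V →ₗ[ℝ] ℝ)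

lemma anti_abs_le (x y : V) : |ω x y| ≤ anorm ω x * ‖y‖ := by
  rw [anti_eq]
  exact (LinearMap.toContinuousLinearMap (ω x)).le_opNorm y

lemma anti_le (x y : V) : ω x y ≤ anorm ω x * ‖y‖ :=
  (le_abs_self _).trans (anti_abs_le ω x y)

lemma anti_nonneg (x : V) : 0 ≤ anorm ω x := by
  rw [anti_eq]; positivity

lemma anti_add (x y : V) : anorm ω (x + y) ≤ anorm ω x + anorm ω y := by
  simp only [anti_eq, map_add]
  exact norm_add_le _ _

lemma anti_smul (c : ℝ) (x : V) : anorm ω (c • x) = |c| * anorm ω x := by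
  simp only [anti_eq, map_smul, norm_smul, Real.norm_eq_abs]

lemma anti_cont : Continuous (anorm ω) := by
  have : anorm ω = fun x => ‖((LinearMap.toContinuousLinearMap (𝕜 := ℝ) (E := V)
    (F' := ℝ)).toLinearMap ∘ₗ ω) x‖ := by
    ext x; rw [anti_eq]; rfl
  rw [this]
  exact (LinearMap.continuous_of_finiteDimensional _).norm

lemma anti_bound : ∃ C : ℝ, 0 < C ∧ ∀ x, anorm ω x ≤ C * ‖x‖ := by
  obtain ⟨C, hC, h⟩ := (LinearMap.toContinuousLinearMap ((LinearMap.toContinuousLinearMap (𝕜 := ℝ)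
    (E := V) (F' := ℝ)).toLinearMap ∘ₗ ω)).isBoundedLinearMap.bound
  refine ⟨C, hC, fun x => ?_⟩
  rw [anti_eq]; exact h x

lemma anti_attain (x : V) : ∃ y, ‖y‖ = 1 ∧ ω x y = anorm ω x := by
  obtain ⟨y₀, hy₀⟩ := exists_norm_eq V (zero_le_one (α := ℝ))
  have hc : Continuous (ω x) := LinearMap.continuous_of_finiteDimensional _
  obtain ⟨y, hy, hmax⟩ := (isCompact_sphere (0 : V) 1).exists_isMaxOn ⟨y₀, by simpa using hy₀⟩
    hc.continuousOn
  have hy1 : ‖y‖ = 1 := by simpa using hy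
  refine ⟨y, hy1, le_antisymm (by simpa [hy1] using anti_le ω x y) ?_⟩
  refine csSup_le ⟨_, y₀, hy₀, rfl⟩ ?_
  rintro r ⟨z, hz, rfl⟩
  exact hmax (by simpa using hz)

lemma anti_dual (hnd : ∀ a : V, (∀ y : V, ω a y = 0) → a = 0) (y : V) :
    ∃ x, anorm ω x ≤ 1 ∧ ω x y = ‖y‖ := by
  obtain ⟨g, hg, hgy⟩ := exists_dual_vector'' ℝ y
  have hinj : Function.Injective ω := by
    rw [← LinearMap.ker_eq_bot, LinearMap.ker_eq_bot']
    intro a ha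
    exact hnd a (fun y => by rw [ha]; rfl)
  have hsurj : Function.Surjective ω :=
    (LinearMap.injective_iff_surjective_of_finrank_eq_finrank
      (Subspace.dual_finrank_eq (K := ℝ) (V := V)).symm).1 hinj
  obtain ⟨x, hx⟩ := hsurj (g : V →ₗ[ℝ] ℝ)
  refine ⟨x, ?_, by rw [hx]; simpa using hgy⟩
  rw [anti_eq, hx]
  exact hg

lemma anti_pos (hnd : ∀ a : V, (∀ y : V, ω a y = 0) → a = 0) {x : V} (hx : x ≠ 0) :
    0 < anorm ω x := by
  rcases (anti_nonneg ω x).lt_or_eq with h | h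
  · exact h
  · exact absurd (hnd x fun y => by
      have := anti_abs_le ω x y
      rw [← h, zero_mul] at this
      exact abs_nonpos_iff.mp this) hx

lemma om_swap (halt : ∀ x : V, ω x x = 0) (x y : V) : ω x y = - ω y x := by
  have := halt (x + y)
  simp only [map_add, LinearMap.add_apply, halt] at this
  linarith

lemma om_decomp (hdim : Module.finrank ℝ V = 2) (halt : ∀ x : V, ω x x = 0) {p x : V}
    (h : ω p x ≠ 0) (z : V) :
    ω p x • z = ω z x • p + ω p z • x := by
  have hli : LinearIndependent ℝ ![p, x] := by
    rw [LinearIndependent.pair_iff]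
    intro s t hst
    have h1 : ω (s • p + t • x) x = 0 := by rw [hst]; simp
    have h2 : ω p (s • p + t • x) = 0 := by rw [hst]; simp
    simp [halt, h] at h1 h2
    exact ⟨h1, h2⟩
  have hz : z ∈ Submodule.span ℝ (Set.range ![p, x]) := by
    rw [hli.span_eq_top_of_card_eq_finrank (by simp [hdim])]; trivial
  simp only [Matrix.range_cons, Matrix.range_empty, Set.union_empty, Set.singleton_union,
    Submodule.mem_span_pair] at hz
  obtain ⟨a, b, rfl⟩ := hz
  simp only [map_add, map_smul, LinearMap.add_apply, LinearMap.smul_apply, halt, smul_eq_mul]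
  module
end anti

section area
variable {V : Type*} [NormedAddCommGroup V] [NormedSpace ℝ V] [MeasurableSpace V] [BorelSpace V]
  [FiniteDimensional ℝ V] [Nontrivial V] (ω : V →ₗ[ℝ] V →ₗ[ℝ] ℝ)

lemma area_map (hdim : Module.finrank ℝ V = 2) (halt : ∀ x : V, ω x x = 0)
    (μ : Measure V) [μ.IsAddHaarMeasure]
    (hμω : ∀ x y : V,
      μ (Set.image2 (fun s t : ℝ => s • x + t • y) (Set.Icc 0 1) (Set.Icc 0 1)) =
        ENNReal.ofReal |ω x y|)
    {p y : V} (h : ω p y = 1) (S : Set (ℝ × ℝ)) :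
    μ {z | (ω z y, ω p z) ∈ S} = volume S := by
  have hdec : ∀ z, ω z y • p + ω p z • y = z := fun z => by
    rw [← om_decomp ω hdim halt (by rw [h]; exact one_ne_zero) z, h, one_smul]
  let L₀ : V ≃ₗ[ℝ] ℝ × ℝ :=
    { toFun := fun z => (ω z y, ω p z)
      map_add' := fun a b => by simp
      map_smul' := fun c a => by simp
      invFun := fun w => w.1 • p + w.2 • y
      left_inv := fun z => hdec z
      right_inv := fun w => by simp [h, halt] }
  let L := L₀.toContinuousLinearEquiv
  have hLa : ∀ z, L z = (ω z y, ω p z) := fun z => rfl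
  have hν : ∀ T : Set (ℝ × ℝ), (μ.map L) T = μ {z | (ω z y, ω p z) ∈ T} := fun T =>
    L.toHomeomorph.measurableEmbedding.map_apply μ T
  have hH : (μ.map L).IsAddHaarMeasure := L.isAddHaarMeasure_map μ
  have hc := Measure.isAddLeftInvariant_eq_smul (μ.map L) (volume : Measure (ℝ × ℝ))
  have hsq : (μ.map L) (Set.Icc (0:ℝ) 1 ×ˢ Set.Icc (0:ℝ) 1) = 1 := by
    rw [hν]
    have h1 := hμω p y
    rw [h, abs_one, ENNReal.ofReal_one] at h1
    rw [← h1]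
    congr 1
    ext z
    simp only [Set.mem_ofPred_eq, Set.mem_prod, Set.mem_image2]
    constructor
    · rintro ⟨h1, h2⟩
      exact ⟨_, h1, _, h2, hdec z⟩
    · rintro ⟨s, hs, t, ht, rfl⟩
      simpa [h, halt] using ⟨hs, ht⟩
  have hsq' : (volume : Measure (ℝ × ℝ)) (Set.Icc (0:ℝ) 1 ×ˢ Set.Icc (0:ℝ) 1) = 1 := by
    rw [Measure.volume_eq_prod, Measure.prod_prod]; simp
  have hc1 : (μ.map L) = volume := by
    have h2 := hsq
    rw [hc, Measure.smul_apply, hsq'] at h2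
    rw [hc]
    have h3 : (μ.map L).addHaarScalarFactor (volume : Measure (ℝ × ℝ)) = 1 := by
      simpa [ENNReal.smul_def] using h2
    rw [h3, one_smul]
  rw [← hν, hc1]

lemma lint_aux (R a : ℝ) (hR : 0 ≤ R) (ha : 0 ≤ a) :
    ∫⁻ u in Set.Ioc 0 R, ENNReal.ofReal (a * u) = ENNReal.ofReal (R ^ 2 * a / 2) := by
  rw [← ofReal_integral_eq_lintegral_ofReal]
  · rw [← intervalIntegral.integral_of_le hR, intervalIntegral.integral_const_mul, integral_id]
    congr 1; ring
  · exact (continuous_const.mul continuous_id).integrableOn_Ioc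
  · filter_upwards [ae_restrict_mem measurableSet_Ioc] with u hu
    exact mul_nonneg ha hu.1.le

lemma vol_open (R α β : ℝ) (hR : 0 ≤ R) (h : α ≤ β) :
    volume {w : ℝ × ℝ | w.1 ∈ Set.Ioc 0 R ∧ w.2 ∈ Set.Ioo (α * w.1) (β * w.1)} =
      ENNReal.ofReal (R ^ 2 * (β - α) / 2) := by
  rw [← lint_aux R (β - α) hR (by linarith), Measure.volume_eq_prod]
  have := volume_regionBetween_eq_lintegral' (μ := (volume : Measure ℝ)) (f := fun u => α * u)
    (g := fun u => β * u) (s := Set.Ioc 0 R) (by fun_prop) (by fun_prop) measurableSet_Ioc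
  unfold regionBetween at this
  rw [this]
  congr 1
  ext u
  simp [sub_mul]

lemma vol_closed (R α β : ℝ) (hR : 0 ≤ R) (h : α ≤ β) :
    volume {w : ℝ × ℝ | w.1 ∈ Set.Ioc 0 R ∧ w.2 ∈ Set.Icc (α * w.1) (β * w.1)} =
      ENNReal.ofReal (R ^ 2 * (β - α) / 2) := by
  rw [← lint_aux R (β - α) hR (by linarith), Measure.volume_eq_prod,
    Measure.prod_apply, ← lintegral_indicator measurableSet_Ioc]
  · congr 1
    ext u
    by_cases hu : u ∈ Set.Ioc 0 R
    · rw [Set.indicator_of_mem hu]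
      have : Prod.mk u ⁻¹' {w : ℝ × ℝ | w.1 ∈ Set.Ioc 0 R ∧ w.2 ∈ Set.Icc (α * w.1) (β * w.1)}
        = Set.Icc (α * u) (β * u) := by
        ext v; simp only [Set.mem_preimage, Set.mem_ofPred_eq, hu, true_and]
      rw [this, Real.volume_Icc]; congr 1; ring
    · rw [Set.indicator_of_notMem hu]
      have : Prod.mk u ⁻¹' {w : ℝ × ℝ | w.1 ∈ Set.Ioc 0 R ∧ w.2 ∈ Set.Icc (α * w.1) (β * w.1)}
        = ∅ := by
        ext v; simp only [Set.mem_preimage, Set.mem_ofPred_eq, hu, false_and, Set.mem_empty_iff_false]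
      rw [this, measure_empty]
  · have h1 : MeasurableSet {w : ℝ × ℝ | w.1 ∈ Set.Ioc 0 R} := measurable_fst measurableSet_Ioc
    have h2 : MeasurableSet {w : ℝ × ℝ | α * w.1 ≤ w.2} :=
      measurableSet_le (by fun_prop) (by fun_prop)
    have h3 : MeasurableSet {w : ℝ × ℝ | w.2 ≤ β * w.1} :=
      measurableSet_le (by fun_prop) (by fun_prop)
    exact h1.inter (h2.inter h3)

/-- The open triangle with vertices `0, p, x`. -/
def oTri (p x : V) : Set V := {z | 0 < ω p z ∧ 0 < ω z x ∧ ω z (x - p) ≤ ω p x}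

lemma oTri_meas (p x : V) : MeasurableSet (oTri ω p x) := by
  have h1 : Continuous (fun z => ω p z) := LinearMap.continuous_of_finiteDimensional (ω p)
  have h2 : ∀ w, Continuous (fun z => ω z w) := fun w =>
    LinearMap.continuous_of_finiteDimensional (ω.flip w)
  exact (measurableSet_lt measurable_const h1.measurable).inter
    ((measurableSet_lt measurable_const (h2 x).measurable).inter
    (measurableSet_le (h2 _).measurable measurable_const))

lemma oTri_area (hdim : Module.finrank ℝ V = 2) (halt : ∀ x : V, ω x x = 0)
    (μ : Measure V) [μ.IsAddHaarMeasure]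
    (hμω : ∀ x y : V,
      μ (Set.image2 (fun s t : ℝ => s • x + t • y) (Set.Icc 0 1) (Set.Icc 0 1)) =
        ENNReal.ofReal |ω x y|) (p x : V) :
    ENNReal.ofReal (ω p x) ≤ 2 * μ (oTri ω p x) := by
  rcases le_or_gt (ω p x) 0 with h | h
  · rw [ENNReal.ofReal_of_nonpos h]; exact zero_le
  set w := ω p x with hw
  have hy : ω p (w⁻¹ • (x - p)) = 1 := by
    simp [halt, ← hw, h.ne']
  have h1 := area_map ω hdim halt μ hμω hy
    {v : ℝ × ℝ | v.1 ∈ Set.Ioc 0 1 ∧ v.2 ∈ Set.Ioo (0 * v.1) (w * v.1)}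
  rw [vol_open 1 0 w zero_le_one h.le] at h1
  have h2 : {z | (ω z (w⁻¹ • (x - p)), ω p z) ∈
      {v : ℝ × ℝ | v.1 ∈ Set.Ioc 0 1 ∧ v.2 ∈ Set.Ioo (0 * v.1) (w * v.1)}} ⊆ oTri ω p x := by
    rintro z ⟨⟨ha, hb⟩, hc, hd⟩
    simp only [map_smul, smul_eq_mul] at ha hb hc hd
    rw [inv_mul_le_iff₀ h] at hb
    rw [mul_inv_cancel_left₀ h.ne'] at hd
    rw [zero_mul] at hc
    refine ⟨hc, ?_, by simpa using hb⟩
    rw [map_sub, om_swap ω halt z p] at hd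
    linarith
  calc ENNReal.ofReal w = 2 * ENNReal.ofReal (1 ^ 2 * (w - 0) / 2) := by
        rw [← ENNReal.ofReal_ofNat 2, ← ENNReal.ofReal_mul zero_le_two]; congr 1; ring
    _ ≤ _ := by
        rw [← h1]; gcongr

end area

section upper
variable {V : Type*} [NormedAddCommGroup V] [NormedSpace ℝ V] [MeasurableSpace V] [BorelSpace V]
  [FiniteDimensional ℝ V] [Nontrivial V] (ω : V →ₗ[ℝ] V →ₗ[ℝ] ℝ)

lemma chord_pt (hdim : Module.finrank ℝ V = 2) (halt : ∀ x : V, ω x x = 0)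
    (hnd : ∀ a : V, (∀ y : V, ω a y = 0) → a = 0) {p q : V} (hp : anorm ω p = 1)
    (hq : anorm ω q = 1) (hpq : 0 < ω p q) :
    ∃ a b : ℝ, 0 ≤ a ∧ 0 ≤ b ∧ anorm ω (a • p + b • q) ≤ 1 ∧ ‖q - p‖ ≤ (a + b) * ω p q := by
  obtain ⟨x, hx, hxy⟩ := anti_dual ω hnd (q - p)
  have hdec := om_decomp ω hdim halt hpq.ne' x
  set w := ω p q with hw
  have hxe : x = (ω x q / w) • p + (ω p x / w) • q := by
    rw [div_eq_inv_mul, div_eq_inv_mul, mul_smul, mul_smul, ← smul_add, ← hdec, smul_smul,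
      inv_mul_cancel₀ hpq.ne', one_smul]
  set a := ω x q / w
  set b := ω p x / w
  have hqp : ω q p = - w := by rw [om_swap ω halt q p]
  have hn : ‖q - p‖ = (a + b) * w := by
    rw [← hxy]
    conv_lhs => rw [hxe]
    simp [halt, hqp, ← hw]; ring
  by_cases hab : a + b ≤ 1
  · refine ⟨1, 0, zero_le_one, le_rfl, by simp [hp], ?_⟩
    rw [hn]; nlinarith
  push Not at hab
  have ha : 0 ≤ a := by
    by_contra ha
    push Not at ha
    -- q = (x + (-a) p)/b
    have hb : 0 < b := by linarith
    have h1 : b • q = x + (-a) • p := by rw [hxe]; module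
    have h2 := anti_add ω x ((-a) • p)
    rw [← h1, anti_smul, anti_smul, hp, hq, abs_of_pos hb, abs_of_pos (by linarith)] at h2
    linarith
  have hb : 0 ≤ b := by
    by_contra hb
    push Not at hb
    have h1 : a • p = x + (-b) • q := by rw [hxe]; module
    have h2 := anti_add ω x ((-b) • q)
    rw [← h1, anti_smul, anti_smul, hp, hq, abs_of_nonneg ha, abs_of_pos (by linarith)] at h2
    linarith
  exact ⟨a, b, ha, hb, by rw [← hxe]; exact hx, hn.le⟩

lemma oTri_sub (hdim : Module.finrank ℝ V = 2) (halt : ∀ x : V, ω x x = 0)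
    {p x z : V} (hp : anorm ω p ≤ 1) (hx : anorm ω x ≤ 1) (hz : z ∈ oTri ω p x)
    (hpx : 0 < ω p x) :
    anorm ω z ≤ 1 ∧ ∃ s t : ℝ, 0 < s ∧ 0 < t ∧ z = s • p + t • x := by
  obtain ⟨h1, h2, h3⟩ := hz
  have hdec := om_decomp ω hdim halt hpx.ne' z
  set w := ω p x with hw
  have hze : z = (ω z x / w) • p + (ω p z / w) • x := by
    rw [div_eq_inv_mul, div_eq_inv_mul, mul_smul, mul_smul, ← smul_add, ← hdec, smul_smul,
      inv_mul_cancel₀ hpx.ne', one_smul]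
  have hs : 0 < ω z x / w := by positivity
  have ht : 0 < ω p z / w := by positivity
  refine ⟨?_, _, _, hs, ht, hze⟩
  have hst : ω z x / w + ω p z / w ≤ 1 := by
    rw [← add_div, div_le_one hpx]
    rw [map_sub, om_swap ω halt z p] at h3
    linarith
  rw [hze]
  refine (anti_add ω _ _).trans ?_
  rw [anti_smul, anti_smul, abs_of_pos hs, abs_of_pos ht]
  nlinarith

lemma oTri_empty (halt : ∀ x : V, ω x x = 0) {p x z : V} (hz : z ∈ oTri ω p x) :
    0 < ω p x := by
  by_contra h
  obtain ⟨h1, h2, h3⟩ := hz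
  rw [map_sub, om_swap ω halt z p] at h3
  linarith

lemma sector_dist_pos (hdim : Module.finrank ℝ V = 2) (halt : ∀ x : V, ω x x = 0)
    (hnd : ∀ a : V, (∀ y : V, ω a y = 0) → a = 0)
    (μ : Measure V) [μ.IsAddHaarMeasure]
    (hμω : ∀ x y : V,
      μ (Set.image2 (fun s t : ℝ => s • x + t • y) (Set.Icc 0 1) (Set.Icc 0 1)) =
        ENNReal.ofReal |ω x y|)
    {C : Set V} (hCa : ∀ a ∈ C, ∀ b ∈ C, a + b ∈ C) (hCs : ∀ c : ℝ, 0 < c → ∀ a ∈ C, c • a ∈ C)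
    {p q : V} (hp : anorm ω p = 1) (hq : anorm ω q = 1) (hpC : p ∈ C) (hqC : q ∈ C)
    (hpq : 0 < ω p q) :
    ENNReal.ofReal ‖q - p‖ ≤ 2 * μ ({z | anorm ω z ≤ 1} ∩ C) := by
  obtain ⟨a, b, ha, hb, hx, hn⟩ := chord_pt ω hdim halt hnd hp hq hpq
  set x := a • p + b • q with hxdef
  have hcomb : ∀ s t : ℝ, 0 ≤ s → 0 ≤ t → 0 < s + t → s • p + t • q ∈ C := by
    intro s t hs ht hst
    rcases hs.eq_or_lt with rfl | hs
    · simpa using hCs t (by simpa using hst) q hqC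
    rcases ht.eq_or_lt with rfl | ht
    · simpa using hCs s hs p hpC
    exact hCa _ (hCs s hs p hpC) _ (hCs t ht q hqC)
  have h1 : ω p x = b * ω p q := by simp [hxdef, halt]
  have h2 : ω x q = a * ω p q := by simp [hxdef, halt]
  have hs1 : oTri ω p x ⊆ {z | anorm ω z ≤ 1} ∩ C := by
    intro z hz
    obtain ⟨hz1, s, t, hs, ht, rfl⟩ := oTri_sub ω hdim halt hp.le hx hz (oTri_empty ω halt hz)
    refine ⟨hz1, ?_⟩
    have : s • p + t • x = (s + t * a) • p + (t * b) • q := by rw [hxdef]; module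
    rw [this]
    exact hcomb _ _ (by positivity) (by positivity) (by positivity)
  have hs2 : oTri ω x q ⊆ {z | anorm ω z ≤ 1} ∩ C := by
    intro z hz
    obtain ⟨hz1, s, t, hs, ht, rfl⟩ := oTri_sub ω hdim halt hx hq.le hz (oTri_empty ω halt hz)
    refine ⟨hz1, ?_⟩
    have : s • x + t • q = (s * a) • p + (s * b + t) • q := by rw [hxdef]; module
    rw [this]
    exact hcomb _ _ (by positivity) (by positivity) (by positivity)
  have hdisj : Disjoint (oTri ω p x) (oTri ω x q) := by
    rw [Set.disjoint_left]
    rintro z ⟨_, hz, _⟩ ⟨hz', _, _⟩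
    rw [om_swap ω halt z x] at hz
    linarith
  calc ENNReal.ofReal ‖q - p‖ ≤ ENNReal.ofReal (ω p x + ω x q) := by
        apply ENNReal.ofReal_le_ofReal; rw [h1, h2]; linarith
    _ ≤ ENNReal.ofReal (ω p x) + ENNReal.ofReal (ω x q) := ENNReal.ofReal_add_le
    _ ≤ 2 * μ (oTri ω p x) + 2 * μ (oTri ω x q) :=
        add_le_add (oTri_area ω hdim halt μ hμω p x) (oTri_area ω hdim halt μ hμω x q)
    _ = 2 * μ (oTri ω p x ∪ oTri ω x q) := by
        rw [measure_union hdisj (oTri_meas ω x q), mul_add]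
    _ ≤ _ := by gcongr; exact Set.union_subset hs1 hs2

lemma sector_ediam (hdim : Module.finrank ℝ V = 2) (halt : ∀ x : V, ω x x = 0)
    (hnd : ∀ a : V, (∀ y : V, ω a y = 0) → a = 0)
    (μ : Measure V) [μ.IsAddHaarMeasure]
    (hμω : ∀ x y : V,
      μ (Set.image2 (fun s t : ℝ => s • x + t • y) (Set.Icc 0 1) (Set.Icc 0 1)) =
        ENNReal.ofReal |ω x y|)
    {C : Set V} (hCa : ∀ a ∈ C, ∀ b ∈ C, a + b ∈ C) (hCs : ∀ c : ℝ, 0 < c → ∀ a ∈ C, c • a ∈ C)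
    (hC0 : (0 : V) ∉ C) :
    Metric.ediam ({z | anorm ω z = 1} ∩ C) ≤ 2 * μ ({z | anorm ω z ≤ 1} ∩ C) := by
  apply Metric.ediam_le
  rintro p ⟨hp, hpC⟩ q ⟨hq, hqC⟩
  change anorm ω p = 1 at hp
  change anorm ω q = 1 at hq
  rw [edist_dist]
  rcases lt_trichotomy (ω p q) 0 with h | h | h
  · rw [dist_eq_norm]
    exact sector_dist_pos ω hdim halt hnd μ hμω hCa hCs hq hp hqC hpC
      (by rw [om_swap ω halt]; linarith)
  · have hp0 : p ≠ 0 := fun h => hC0 (h ▸ hpC)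
    have : ∃ y, ω p y ≠ 0 := by
      by_contra hcon
      push Not at hcon
      exact hp0 (hnd p hcon)
    obtain ⟨y, hy⟩ := this
    have hdec := om_decomp ω hdim halt hy q
    rw [h, zero_smul, add_zero] at hdec
    have hqe : q = (ω q y / ω p y) • p := by
      rw [div_eq_inv_mul, mul_smul, ← hdec, smul_smul, inv_mul_cancel₀ hy, one_smul]
    set c := ω q y / ω p y
    have hc : |c| = 1 := by
      have := anti_smul ω c p
      rw [← hqe, hp, hq] at this
      linarith
    have hqp : q = p := by
      rcases (abs_eq zero_le_one).1 hc with hc | hc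
      · rw [hqe, hc, one_smul]
      · exfalso
        apply hC0
        have := hCa p hpC q hqC
        rw [hqe, hc] at this
        simpa using this
    simp [hqp]
  · rw [dist_comm, dist_eq_norm]
    exact sector_dist_pos ω hdim halt hnd μ hμω hCa hCs hp hq hpC hqC h

/-- The `k`-th sector of slope width `1/(n+1)` in the right half plane. -/
def sect (e f : V) (n : ℕ) (k : ℤ) : Set V :=
  {z | 0 < ω z f ∧ k * ω z f ≤ (n + 1) * ω e z ∧ (n + 1) * ω e z < (k + 1) * ω z f}

lemma sect_meas (e f : V) (n : ℕ) (k : ℤ) : MeasurableSet (sect ω e f n k) := by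
  have h1 : Measurable (fun z => ω e z) :=
    (LinearMap.continuous_of_finiteDimensional (ω e)).measurable
  have h2 : Measurable (fun z => ω z f) :=
    (LinearMap.continuous_of_finiteDimensional (ω.flip f)).measurable
  exact (measurableSet_lt measurable_const h2).inter
    ((measurableSet_le (h2.const_mul _) (h1.const_mul _)).inter
    (measurableSet_lt (h1.const_mul _) (h2.const_mul _)))

lemma upper_half (hdim : Module.finrank ℝ V = 2) (halt : ∀ x : V, ω x x = 0)
    (hnd : ∀ a : V, (∀ y : V, ω a y = 0) → a = 0)
    (μ : Measure V) [μ.IsAddHaarMeasure]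
    (hμω : ∀ x y : V,
      μ (Set.image2 (fun s t : ℝ => s • x + t • y) (Set.Icc 0 1) (Set.Icc 0 1)) =
        ENNReal.ofReal |ω x y|)
    {e f : V} (hef : ω e f = 1) :
    μH[1] ({z | anorm ω z = 1} ∩ {z | 0 < ω z f}) ≤
      2 * μ ({z | anorm ω z ≤ 1} ∩ {z | 0 < ω z f}) := by
  set I : Set V := {z | anorm ω z ≤ 1} with hI
  have hImeas : MeasurableSet I := measurableSet_le (anti_cont ω).measurable measurable_const
  have hdiam : ∀ n k, Metric.ediam ({z | anorm ω z = 1} ∩ sect ω e f n k) ≤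
      2 * μ (I ∩ sect ω e f n k) := by
    intro n k
    apply sector_ediam ω hdim halt hnd μ hμω
    · rintro a ⟨ha1, ha2, ha3⟩ b ⟨hb1, hb2, hb3⟩
      refine ⟨?_, ?_, ?_⟩ <;> simp only [map_add, LinearMap.add_apply, mul_add] <;> linarith
    · rintro c hc a ⟨ha1, ha2, ha3⟩
      refine ⟨?_, ?_, ?_⟩ <;> simp only [map_smul, LinearMap.smul_apply, smul_eq_mul]
      · positivity
      · nlinarith
      · nlinarith
    · rintro ⟨h, _⟩
      simp at h
  have hdisj : ∀ n : ℕ, Pairwise (Function.onFun Disjoint (fun k => I ∩ sect ω e f n k)) := by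
    intro n k l hkl
    rw [Function.onFun, Set.disjoint_left]
    rintro z ⟨_, h1, h2, h3⟩ ⟨_, _, h5, h6⟩
    apply hkl
    have a1 : (k : ℝ) < l + 1 := lt_of_mul_lt_mul_right (h2.trans_lt h6) h1.le
    have a2 : (l : ℝ) < k + 1 := lt_of_mul_lt_mul_right (h5.trans_lt h3) h1.le
    have a3 : k < l + 1 := by exact_mod_cast a1
    have a4 : l < k + 1 := by exact_mod_cast a2
    omega
  have hcov : ∀ n : ℕ, {z : V | 0 < ω z f} ⊆ ⋃ k, sect ω e f n k := by
    intro n z hz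
    change 0 < ω z f at hz
    rw [Set.mem_iUnion]
    refine ⟨⌊(n + 1) * ω e z / ω z f⌋, hz, ?_, ?_⟩
    · rw [← le_div_iff₀ hz]; exact Int.floor_le _
    · rw [← div_lt_iff₀ hz]; exact Int.lt_floor_add_one _
  have hsum : ∀ n : ℕ, ∑' k : ℤ, Metric.ediam ({z | anorm ω z = 1} ∩ sect ω e f n k) ^ (1:ℝ) ≤
      2 * μ (I ∩ {z | 0 < ω z f}) := by
    intro n
    calc _ ≤ ∑' k : ℤ, 2 * μ (I ∩ sect ω e f n k) := by
          refine ENNReal.tsum_le_tsum fun k => ?_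
          rw [ENNReal.rpow_one]; exact hdiam n k
      _ = 2 * μ (⋃ k, I ∩ sect ω e f n k) := by
          rw [ENNReal.tsum_mul_left, measure_iUnion (hdisj n)
            (fun k => hImeas.inter (sect_meas ω e f n k))]
      _ ≤ _ := by
          gcongr
          refine Set.iUnion_subset fun k z hz => ⟨hz.1, hz.2.1⟩
  have hsmall : ∀ (n : ℕ) (k : ℤ), Metric.ediam ({z | anorm ω z = 1} ∩ sect ω e f n k) ≤
      ENNReal.ofReal (‖f‖ ^ 2 * (1 / ((n : ℝ) + 1))) := by
    intro n k
    refine (hdiam n k).trans ?_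
    have hn : (0:ℝ) < n + 1 := by positivity
    have h1 := area_map ω hdim halt μ hμω hef {w : ℝ × ℝ | w.1 ∈ Set.Ioc 0 ‖f‖ ∧
      w.2 ∈ Set.Icc (k / ((n:ℝ) + 1) * w.1) ((k + 1) / ((n:ℝ) + 1) * w.1)}
    rw [vol_closed _ _ _ (norm_nonneg _) (by gcongr; linarith)] at h1
    calc 2 * μ (I ∩ sect ω e f n k) ≤ 2 * ENNReal.ofReal
          (‖f‖ ^ 2 * ((k + 1) / ((n:ℝ) + 1) - k / ((n:ℝ) + 1)) / 2) := by
          rw [← h1]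
          gcongr
          rintro z ⟨hz, hz1, hz2, hz3⟩
          refine ⟨⟨hz1, ?_⟩, ?_, ?_⟩
          · have := anti_le ω z f
            have hz' : anorm ω z ≤ 1 := hz
            have := norm_nonneg f
            dsimp only
            nlinarith
          · dsimp only
            rw [div_mul_eq_mul_div, div_le_iff₀ hn]; linarith
          · dsimp only
            rw [div_mul_eq_mul_div, le_div_iff₀ hn]; linarith
      _ = _ := by
        rw [← ENNReal.ofReal_ofNat 2, ← ENNReal.ofReal_mul zero_le_two]; congr 1; ring
  have hlim : Filter.Tendsto (fun n : ℕ => ENNReal.ofReal (‖f‖ ^ 2 * (1 / ((n : ℝ) + 1))))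
      Filter.atTop (nhds 0) := by
    rw [← ENNReal.ofReal_zero]
    apply ENNReal.tendsto_ofReal
    simpa using (tendsto_one_div_add_atTop_nhds_zero_nat (𝕜 := ℝ)).const_mul (‖f‖ ^ 2)
  refine (Measure.hausdorffMeasure_le_liminf_tsum 1 _ _ hlim
    (fun (n : ℕ) (k : ℤ) => {z | anorm ω z = 1} ∩ sect ω e f n k)
    (Filter.Eventually.of_forall hsmall)
    (Filter.Eventually.of_forall fun n z hz => ?_)).trans ?_
  · rw [← Set.inter_iUnion]
    exact ⟨hz.1, hcov n hz.2⟩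
  · refine (Filter.liminf_le_liminf (Filter.Eventually.of_forall hsum)).trans ?_
    simp

end upper

section lower
variable {V : Type*} [NormedAddCommGroup V] [NormedSpace ℝ V] [MeasurableSpace V] [BorelSpace V]
  [FiniteDimensional ℝ V] [Nontrivial V] (ω : V →ₗ[ℝ] V →ₗ[ℝ] ℝ)

lemma upper_total (hdim : Module.finrank ℝ V = 2) (halt : ∀ x : V, ω x x = 0)
    (hnd : ∀ a : V, (∀ y : V, ω a y = 0) → a = 0)
    (μ : Measure V) [μ.IsAddHaarMeasure]
    (hμω : ∀ x y : V,
      μ (Set.image2 (fun s t : ℝ => s • x + t • y) (Set.Icc 0 1) (Set.Icc 0 1)) =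
        ENNReal.ofReal |ω x y|) :
    μH[1] {z | anorm ω z = 1} ≤ 2 * μ {z | anorm ω z ≤ 1} := by
  obtain ⟨e, he⟩ := exists_ne (0 : V)
  obtain ⟨y, hy⟩ : ∃ y, ω e y ≠ 0 := by
    by_contra hcon
    push Not at hcon
    exact he (hnd e hcon)
  set f := (ω e y)⁻¹ • y with hf
  have hef : ω e f = 1 := by simp [hf, hy]
  have hf0 : f ≠ 0 := by rintro h; simp [h] at hef
  have hfm : Measurable (fun z => ω z f) :=
    (LinearMap.continuous_of_finiteDimensional (ω.flip f)).measurable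
  have hImeas : MeasurableSet {z | anorm ω z ≤ 1} :=
    measurableSet_le (anti_cont ω).measurable measurable_const
  have h1 := upper_half ω hdim halt hnd μ hμω hef
  have h2 := upper_half ω hdim halt hnd μ hμω (e := -e) (f := -f) (by simpa using hef)
  have h3 : μH[1] ({z | anorm ω z = 1} ∩ {z | ω z f = 0}) = 0 := by
    have : {z | anorm ω z = 1} ∩ {z | ω z f = 0} ⊆
        {(1 / anorm ω f) • f, (-(1 / anorm ω f)) • f} := by
      rintro z ⟨hz1, hz2⟩
      change anorm ω z = 1 at hz1
      change ω z f = 0 at hz2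
      have hdec := om_decomp ω hdim halt (by rw [hef]; exact one_ne_zero) z
      rw [hef, one_smul, hz2, zero_smul, zero_add] at hdec
      have hpos := anti_pos ω hnd hf0
      have hc : |ω e z| = 1 / anorm ω f := by
        have := anti_smul ω (ω e z) f
        rw [← hdec, hz1] at this
        rw [eq_div_iff hpos.ne']; exact this.symm
      rcases (abs_eq (by positivity)).1 hc with h | h
      · left; rw [← h]; exact hdec
      · right
        rw [Set.mem_singleton_iff, ← h]; exact hdec
    have := Measure.nullSingletonClass_hausdorff V (d := 1) one_pos
    exact measure_mono_null ‹_› (Set.Finite.measure_zero (Set.toFinite _) _)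
  have hcov : {z | anorm ω z = 1} ⊆ (({z | anorm ω z = 1} ∩ {z | 0 < ω z f}) ∪
      ({z | anorm ω z = 1} ∩ {z | 0 < ω z (-f)})) ∪ ({z | anorm ω z = 1} ∩ {z | ω z f = 0}) := by
    intro z hz
    rcases lt_trichotomy (ω z f) 0 with h | h | h
    · exact Or.inl (Or.inr ⟨hz, by simpa using h⟩)
    · exact Or.inr ⟨hz, h⟩
    · exact Or.inl (Or.inl ⟨hz, h⟩)
  calc _ ≤ _ := measure_mono hcov
    _ ≤ (2 * μ ({z | anorm ω z ≤ 1} ∩ {z | 0 < ω z f}) +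
        2 * μ ({z | anorm ω z ≤ 1} ∩ {z | 0 < ω z (-f)})) + 0 := by
      refine (measure_union_le _ _).trans (add_le_add ((measure_union_le _ _).trans
        (add_le_add h1 h2)) h3.le)
    _ = 2 * μ (({z | anorm ω z ≤ 1} ∩ {z | 0 < ω z (-f)}) ∪
        ({z | anorm ω z ≤ 1} ∩ {z | 0 < ω z f})) := by
      rw [add_zero, ← mul_add, add_comm, measure_union]
      · rw [Set.disjoint_left]
        rintro z ⟨_, h4⟩ ⟨_, h5⟩
        change 0 < ω z (-f) at h4
        change 0 < ω z f at h5
        rw [map_neg] at h4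
        linarith
      · exact hImeas.inter (measurableSet_lt measurable_const hfm)
    _ ≤ _ := by
      gcongr
      exact Set.union_subset Set.inter_subset_left Set.inter_subset_left

/-- The (half-open) cone over the part of the anticircle in `t`. -/
def coneOver (t : Set V) : Set V :=
  {z | ∃ s : ℝ, 0 < s ∧ s ≤ 1 ∧ ∃ q ∈ t, anorm ω q = 1 ∧ z = s • q}

lemma cone_bound (hdim : Module.finrank ℝ V = 2) (halt : ∀ x : V, ω x x = 0)
    (μ : Measure V) [μ.IsAddHaarMeasure]
    (hμω : ∀ x y : V,
      μ (Set.image2 (fun s t : ℝ => s • x + t • y) (Set.Icc 0 1) (Set.Icc 0 1)) =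
        ENNReal.ofReal |ω x y|)
    {K : ℝ} (hK : 0 < K) (hKb : ∀ x, anorm ω x ≤ K * ‖x‖) {r : ℝ} (hr : 0 ≤ r) (hKr : K * r < 1)
    {t : Set V} (ht : Metric.ediam t ≤ ENNReal.ofReal r) :
    2 * μ (coneOver ω t) ≤ ENNReal.ofReal (1 / (1 - K * r)) * Metric.ediam t := by
  by_cases hne : ∃ p ∈ t, anorm ω p = 1
  swap
  · have : coneOver ω t = ∅ := by
      ext z
      simp only [Set.mem_empty_iff_false, iff_false]
      rintro ⟨s, _, _, q, hq, hq1, _⟩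
      exact hne ⟨q, hq, hq1⟩
    simp [this]
  obtain ⟨p, hpt, hp⟩ := hne
  obtain ⟨y, hy, hpy⟩ := anti_attain ω p
  rw [hp] at hpy
  have hfin : Metric.ediam t ≠ ⊤ := (ht.trans_lt ENNReal.ofReal_lt_top).ne
  set d := Metric.diam t with hd
  have hdr : d ≤ r := ENNReal.toReal_le_of_le_ofReal hr ht
  have hed : Metric.ediam t = ENNReal.ofReal d := (ENNReal.ofReal_toReal hfin).symm
  have hdist : ∀ a ∈ t, ∀ b ∈ t, ‖a - b‖ ≤ d := fun a ha b hb => by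
    rw [← dist_eq_norm]; exact Metric.dist_le_diam_of_mem' hfin ha hb
  have hom : ∀ a ∈ t, ∀ b ∈ t, ω p a - ω p b ≤ d := fun a ha b hb => by
    rw [← map_sub]
    have := anti_le ω p (a - b)
    rw [hp, one_mul] at this
    exact this.trans (hdist a ha b hb)
  set J := (fun q => ω p q) '' t with hJ
  have hJ0 : (0:ℝ) ∈ J := ⟨p, hpt, halt p⟩
  have hJa : BddAbove J := ⟨d, by
    rintro _ ⟨q, hq, rfl⟩
    have := hom q hq p hpt
    rw [halt] at this; simpa using this⟩
  have hJb : BddBelow J := ⟨-d, by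
    rintro _ ⟨q, hq, rfl⟩
    have := hom p hpt q hq
    rw [halt] at this; dsimp only; linarith⟩
  set α := sInf J
  set β := sSup J
  have hα : α ≤ 0 := csInf_le hJb hJ0
  have hβ : 0 ≤ β := le_csSup hJa hJ0
  have hβα : β - α ≤ d := by
    have : β ≤ d + α := by
      refine csSup_le ⟨0, hJ0⟩ ?_
      rintro _ ⟨q, hq, rfl⟩
      have : ω p q - d ≤ α := by
        refine le_csInf ⟨0, hJ0⟩ ?_
        rintro _ ⟨q', hq', rfl⟩
        have := hom q hq q' hq'
        dsimp only; linarith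
      dsimp only; linarith
    linarith
  set c := 1 / (1 - K * r) with hc
  have hpos : 0 < 1 - K * r := by linarith
  have hc0 : 0 < c := by positivity
  have h1 := area_map ω hdim halt μ hμω hpy {w : ℝ × ℝ | w.1 ∈ Set.Ioc 0 1 ∧
      w.2 ∈ Set.Icc (c * α * w.1) (c * β * w.1)}
  rw [vol_closed _ _ _ zero_le_one (by gcongr; linarith)] at h1
  have hsub : coneOver ω t ⊆ {z | (ω z y, ω p z) ∈ {w : ℝ × ℝ | w.1 ∈ Set.Ioc 0 1 ∧
      w.2 ∈ Set.Icc (c * α * w.1) (c * β * w.1)}} := by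
    rintro z ⟨s, hs0, hs1, q, hq, hq1, rfl⟩
    have ha1 : ω q y ≤ 1 := by
      have := anti_le ω q y
      rwa [hq1, hy, mul_one] at this
    have ha2 : 1 - K * r ≤ ω q y := by
      have := anti_le ω (p - q) y
      rw [hy, mul_one, map_sub, LinearMap.sub_apply, hpy] at this
      have h2 := hKb (p - q)
      have h3 : K * ‖p - q‖ ≤ K * r := by gcongr; exact (hdist p hpt q hq).trans hdr
      linarith
    have hca : 1 ≤ c * ω q y := by
      rw [hc, div_mul_eq_mul_div, le_div_iff₀ hpos]; linarith
    have hb1 : α ≤ ω p q := csInf_le hJb ⟨q, hq, rfl⟩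
    have hb2 : ω p q ≤ β := le_csSup hJa ⟨q, hq, rfl⟩
    have ha0 : 0 < ω q y := by linarith
    simp only [Set.mem_ofPred_eq, map_smul, LinearMap.smul_apply, smul_eq_mul, Set.mem_Ioc,
      Set.mem_Icc]
    refine ⟨⟨by positivity, by nlinarith⟩, ?_, ?_⟩
    · have : c * ω q y * α ≤ ω p q := by nlinarith
      nlinarith
    · have : ω p q ≤ c * ω q y * β := by nlinarith
      nlinarith
  calc 2 * μ (coneOver ω t) ≤ 2 * ENNReal.ofReal (1 ^ 2 * (c * β - c * α) / 2) := by
        rw [← h1]; gcongr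
    _ = ENNReal.ofReal (c * (β - α)) := by
        rw [← ENNReal.ofReal_ofNat 2, ← ENNReal.ofReal_mul zero_le_two]; congr 1; ring
    _ ≤ ENNReal.ofReal (c * d) := by gcongr
    _ = _ := by rw [hed, ENNReal.ofReal_mul hc0.le]

lemma lower_total (hdim : Module.finrank ℝ V = 2) (halt : ∀ x : V, ω x x = 0)
    (hnd : ∀ a : V, (∀ y : V, ω a y = 0) → a = 0)
    (μ : Measure V) [μ.IsAddHaarMeasure]
    (hμω : ∀ x y : V,
      μ (Set.image2 (fun s t : ℝ => s • x + t • y) (Set.Icc 0 1) (Set.Icc 0 1)) =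
        ENNReal.ofReal |ω x y|) :
    2 * μ {z | anorm ω z ≤ 1} ≤ μH[1] {z | anorm ω z = 1} := by
  obtain ⟨K, hK, hKb⟩ := anti_bound ω
  have key : ∀ r : ℝ, 0 < r → K * r < 1 →
      2 * μ {z | anorm ω z ≤ 1} ≤
        ENNReal.ofReal (1 / (1 - K * r)) * μH[1] {z | anorm ω z = 1} := by
    intro r hr hKr
    have hc0 : 0 < 1 / (1 - K * r) := by
      have : 0 < 1 - K * r := by linarith
      positivity
    set c := ENNReal.ofReal (1 / (1 - K * r)) with hc
    have hcne : c ≠ 0 := by rw [hc]; simpa using hc0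
    have hcfin : c ≠ ⊤ := ENNReal.ofReal_ne_top
    rw [← ENNReal.div_le_iff' hcne hcfin, Measure.hausdorffMeasure_apply]
    refine le_iSup₂_of_le (ENNReal.ofReal r) (by simpa using hr) ?_
    refine le_iInf fun t => le_iInf fun hcov => le_iInf fun hdiam => ?_
    rw [ENNReal.div_le_iff' hcne hcfin, ← ENNReal.tsum_mul_left]
    have hsub : {z | anorm ω z ≤ 1} ⊆ {0} ∪ ⋃ n, coneOver ω (t n) := by
      intro z hz
      change anorm ω z ≤ 1 at hz
      rcases eq_or_ne z 0 with rfl | hz0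
      · left; rfl
      right
      have hpos := anti_pos ω hnd hz0
      have hq1 : anorm ω ((anorm ω z)⁻¹ • z) = 1 := by
        rw [anti_smul, abs_of_pos (by positivity), inv_mul_cancel₀ hpos.ne']
      obtain ⟨n, hn⟩ := Set.mem_iUnion.1 (hcov hq1)
      refine Set.mem_iUnion.2 ⟨n, anorm ω z, hpos, hz, _, hn, hq1, ?_⟩
      rw [smul_smul, mul_inv_cancel₀ hpos.ne', one_smul]
    calc 2 * μ {z | anorm ω z ≤ 1} ≤ 2 * (μ {0} + ∑' n, μ (coneOver ω (t n))) := by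
          gcongr
          exact (measure_mono hsub).trans ((measure_union_le _ _).trans
            (add_le_add le_rfl (measure_iUnion_le _)))
      _ = ∑' n, 2 * μ (coneOver ω (t n)) := by
          rw [measure_singleton, zero_add, ENNReal.tsum_mul_left]
      _ ≤ _ := by
          refine ENNReal.tsum_le_tsum fun n => ?_
          by_cases hne : (t n).Nonempty
          · simp only [hne, iSup_pos, ENNReal.rpow_one]
            exact cone_bound ω hdim halt μ hμω hK hKb hr.le hKr (hdiam n)
          · rw [Set.not_nonempty_iff_eq_empty] at hne
            have : coneOver ω (t n) = ∅ := by
              ext z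
              simp [coneOver, hne]
            simp [this]
  have hlim : Filter.Tendsto (fun r : ℝ => ENNReal.ofReal (1 / (1 - K * r)) *
      μH[1] {z | anorm ω z = 1}) (nhdsWithin 0 (Set.Ioi 0))
      (nhds (1 * μH[1] {z | anorm ω z = 1})) := by
    apply ENNReal.Tendsto.mul_const _ (Or.inl one_ne_zero)
    rw [← ENNReal.ofReal_one]
    apply ENNReal.tendsto_ofReal
    have : ContinuousAt (fun r : ℝ => 1 / (1 - K * r)) 0 := by
      apply ContinuousAt.div <;> first | fun_prop | simp
    have h := this.tendsto
    simp only [mul_zero, sub_zero, div_one] at h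
    exact h.mono_left nhdsWithin_le_nhds
  rw [one_mul] at hlim
  refine ge_of_tendsto hlim ?_
  have h1 : ∀ᶠ r : ℝ in nhdsWithin 0 (Set.Ioi 0), r < 1 / K :=
    nhdsWithin_le_nhds (gt_mem_nhds (by positivity))
  filter_upwards [h1, self_mem_nhdsWithin] with r hr1 hr0
  exact key r hr0 (by rw [lt_div_iff₀ hK] at hr1; linarith)

lemma frontier_anti (hnd : ∀ a : V, (∀ y : V, ω a y = 0) → a = 0) :
    frontier {z | anorm ω z ≤ 1} = {z | anorm ω z = 1} := by
  apply Set.Subset.antisymm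
  · exact frontier_le_subset_eq (anti_cont ω) continuous_const
  · intro p hp
    change anorm ω p = 1 at hp
    refine ⟨subset_closure hp.le, fun hint => ?_⟩
    have hcont : Filter.Tendsto (fun c : ℝ => c • p) (nhds 1) (nhds p) := by
      have : Continuous (fun c : ℝ => c • p) := by fun_prop
      simpa using this.tendsto 1
    have h1 := hcont.eventually (mem_interior_iff_mem_nhds.1 hint)
    have h2 : ∀ᶠ c : ℝ in nhdsWithin 1 (Set.Ioi 1), anorm ω (c • p) ≤ 1 :=
      nhdsWithin_le_nhds h1
    obtain ⟨c, hc, hc1⟩ := (h2.and self_mem_nhdsWithin).exists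
    change 1 < c at hc1
    rw [anti_smul, hp, mul_one, abs_of_pos (by linarith)] at hc
    linarith

end lower

/-- The perimeter (in the norm, as one-dimensional Hausdorff measure of the boundary) of
the anticircle of radius `ρ` satisfies `ρ · L(ρ ∂I) = 2 · area(ρ I)`. -/
theorem stmt16 {V : Type*} [NormedAddCommGroup V] [NormedSpace ℝ V]
    [MeasurableSpace V] [BorelSpace V]
    (hdim : Module.finrank ℝ V = 2)
    (ω : V →ₗ[ℝ] V →ₗ[ℝ] ℝ)
    (halt : ∀ x : V, ω x x = 0)
    (hnd : ∀ a : V, (∀ y : V, ω a y = 0) → a = 0)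
    (μ : Measure V) [μ.IsAddHaarMeasure]
    (hμω : ∀ x y : V,
      μ (Set.image2 (fun s t : ℝ => s • x + t • y) (Set.Icc 0 1) (Set.Icc 0 1)) =
        ENNReal.ofReal |ω x y|)
    (ρ : ℝ) (hρ : 0 < ρ) :
    ρ * (μH[1] (frontier {x : V | anorm ω x ≤ ρ})).toReal =
      2 * (μ {x : V | anorm ω x ≤ ρ}).toReal := by
  have : FiniteDimensional ℝ V := Module.finite_of_finrank_pos (by omega)
  have : Nontrivial V := Module.nontrivial_of_finrank_pos (R := ℝ) (by omega)
  have hmain : μH[1] (frontier {z | anorm ω z ≤ 1}) = 2 * μ {z | anorm ω z ≤ 1} := by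
    rw [frontier_anti ω hnd]
    exact le_antisymm (upper_total ω hdim halt hnd μ hμω) (lower_total ω hdim halt hnd μ hμω)
  have hset : {x : V | anorm ω x ≤ ρ} = ρ • {z | anorm ω z ≤ 1} := by
    ext z
    rw [Set.mem_smul_set_iff_inv_smul_mem₀ hρ.ne']
    change anorm ω z ≤ ρ ↔ anorm ω (ρ⁻¹ • z) ≤ 1
    rw [anti_smul, abs_of_pos (by positivity), inv_mul_le_iff₀ hρ, mul_one]
  have hfr : frontier (ρ • {z | anorm ω z ≤ 1}) = ρ • frontier {z | anorm ω z ≤ 1} :=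
    ((Homeomorph.smulOfNeZero ρ hρ.ne').image_frontier _).symm
  rw [hset, hfr, Measure.hausdorffMeasure_smul₀ zero_le_one hρ.ne', hmain, Measure.addHaar_smul,
    hdim, ENNReal.smul_def, smul_eq_mul, ENNReal.toReal_mul, ENNReal.toReal_mul,
    ENNReal.toReal_mul, ENNReal.toReal_ofReal (abs_nonneg _), abs_of_pos (by positivity)]
  simp [abs_of_pos hρ]
  ring
end
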